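/- arXiv:math/0206167 — 2 statements merged into one kernel-verified Lean document; each statement's English description precedes it below -/
import Mathlib

section
/- Let C be the commutative unital ℂ-algebra with underlying vector space ℂ² and multiplication (α',α'')·(β',β'') = (α'β', α'β'' + α''β') (i.e., C ≅ ℂ[x]/(x²)). On the set Θ^B of power series with ℂ²-coefficients, the type-B boxed convolution ⊛^B coincides with the type-A boxed convolution with coefficients in C: for all f, g ∈ Θ^B, f ⊛^B g = f ⊛^A_C g. -/
open scoped Classical

namespace NCPB

/-- A collection of subsets of `α` is a partition: blocks are nonempty and
every element lies in exactly one block. -/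
def IsPartition {α : Type*} (P : Set (Set α)) : Prop :=
  (∀ B ∈ P, B.Nonempty) ∧ ∀ a : α, ∃! B, B ∈ P ∧ a ∈ B

/-- The non-crossing condition for a collection of subsets of a linear order:
if `a < b < c < d`, `a, c` lie in a block `B` and `b, d` lie in a block `C`,
then `b ∈ B` (i.e. the blocks coincide). -/
def IsNC {α : Type*} [LinearOrder α] (P : Set (Set α)) : Prop :=
  ∀ B ∈ P, ∀ C ∈ P, ∀ a b c d : α, a < b → b < c → c < d →
    a ∈ B → c ∈ B → b ∈ C → d ∈ C → b ∈ B

/-- A non-crossing partition of a linear order. -/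
def NCPart {α : Type*} [LinearOrder α] (P : Set (Set α)) : Prop :=
  IsPartition P ∧ IsNC P

/-- The set `[±m] = {1 < 2 < ... < m < -1 < -2 < ... < -m}` is encoded as `Fin (2*m)`,
position `k < m` encoding `k+1` and position `m + j` encoding `-(j+1)`.
`negMap` is the inversion map `a ↦ -a`. -/
def negMap (m : ℕ) (k : Fin (2*m)) : Fin (2*m) :=
  ⟨(k.val + m) % (2*m), Nat.mod_lt _ (Nat.lt_of_le_of_lt (Nat.zero_le _) k.isLt)⟩

/-- Image of a subset of `[±m]` under the inversion map, i.e. `X ↦ -X`. -/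
def negSet (m : ℕ) (X : Set (Fin (2*m))) : Set (Fin (2*m)) := negMap m '' X

/-- The absolute value map `[±m] → {1,...,m}`, `±i ↦ i`. -/
def absMap (m : ℕ) (k : Fin (2*m)) : Fin m :=
  ⟨k.val % m, Nat.mod_lt _ (by have := k.isLt; omega)⟩

/-- A non-crossing partition of type B: a non-crossing partition of `[±m]`
invariant under the inversion map. -/
def NCBPart (m : ℕ) (π : Set (Set (Fin (2*m)))) : Prop :=
  NCPart π ∧ ∀ B ∈ π, negSet m B ∈ π

/-- The collection of sets `Abs(X)`, `X` a block of `π`. -/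
def absPart (m : ℕ) (π : Set (Set (Fin (2*m)))) : Set (Set (Fin m)) :=
  {F | ∃ X ∈ π, F = absMap m '' X}

/-- The embedding of `{1,...,m}` onto the odd-indexed positions of the interleaved
set `1 < 1̄ < 2 < 2̄ < ... < m < m̄` (encoded as `Fin (2*m)`): `i ↦ i` (even positions). -/
def evens (m : ℕ) (i : Fin m) : Fin (2*m) := ⟨2*i.val, by have := i.isLt; omega⟩

/-- The embedding of the barred copy `{1̄,...,m̄}` into the interleaved set: odd positions. -/
def odds (m : ℕ) (i : Fin m) : Fin (2*m) := ⟨2*i.val+1, by have := i.isLt; omega⟩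

/-- `P` refines... rather: every block of `P` is contained in a block of `Q`
(the partial order on partitions by reverse refinement: `P ≤ Q`). -/
def Refines {α : Type*} (P Q : Set (Set α)) : Prop := ∀ B ∈ P, ∃ C ∈ Q, B ⊆ C

/-- The collection `p ∪ q̄` of subsets of the interleaved set
`1 < 1̄ < 2 < 2̄ < ... < m < m̄`, with `p` living on the unbarred copy and `q` on the
barred copy. -/
def interleave (m : ℕ) (p q : Set (Set (Fin m))) : Set (Set (Fin (2*m))) :=
  ((fun B => evens m '' B) '' p) ∪ ((fun B => odds m '' B) '' q)

/-- `q` is the Kreweras complement of `p`: `q` is the largest non-crossing partition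
(in the reverse-refinement order) such that `p ∪ q̄` is a non-crossing partition of the
interleaved set `1 < 1̄ < ... < m < m̄`. -/
def IsKr (m : ℕ) (p q : Set (Set (Fin m))) : Prop :=
  NCPart q ∧ NCPart (interleave m p q) ∧
  ∀ q', NCPart q' → NCPart (interleave m p q') → Refines q' q

/-- Two sets cross: there are `a < b < c < d` with `a, c ∈ B` and `b, d ∈ C`. -/
def Crossing {α : Type*} [LinearOrder α] (B C : Set α) : Prop :=
  ∃ a b c d : α, a < b ∧ b < c ∧ c < d ∧ a ∈ B ∧ c ∈ B ∧ b ∈ C ∧ d ∈ C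

/-- Two members of a non-crossing family of pairwise disjoint sets: disjoint,
and neither crosses the other. -/
def PairNC {α : Type*} [LinearOrder α] (B C : Set α) : Prop :=
  Disjoint B C ∧ ¬ Crossing B C ∧ ¬ Crossing C B

end NCPB
namespace NCPB

/-- `X` is the chosen representative of the pair of blocks `{X, -X}`:
the least element of `X ∪ (-X)` lies in `X`. -/
def IsRep (m : ℕ) (X : Set (Fin (2*m))) : Prop :=
  ∃ x, IsLeast (X ∪ negSet m X) x ∧ x ∈ X

/-- The first component `γ'_m` of the coefficients of the boxed convolution of type B:
a summation over `NC^A(m)` (each `p` paired with its Kreweras complement). -/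
noncomputable def gammaFst (a' b' : ℕ → ℂ) (m : ℕ) : ℂ :=
  ∑ᶠ (pq : Set (Set (Fin m)) × Set (Set (Fin m)))
    (_ : NCPart pq.1 ∧ IsKr m pq.1 pq.2),
    (∏ᶠ F ∈ pq.1, a' F.ncard) * (∏ᶠ E ∈ pq.2, b' E.ncard)

/-- The second component `γ''_m` of the coefficients of the boxed convolution of type B:
a summation over `NC^B(m)`, split according to whether `π` or `Kr(π)` has the
zero-block `Z` (the third component of the summation variable `t`). The products run
over a choice of one block out of each pair `{X, -X}` of non-zero-blocks. -/
noncomputable def gammaSnd (a' a'' b' b'' : ℕ → ℂ) (m : ℕ) : ℂ :=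
  (∑ᶠ (t : (Set (Set (Fin (2*m))) × Set (Set (Fin (2*m)))) × Set (Fin (2*m)))
    (_ : NCBPart m t.1.1 ∧ IsKr (2*m) t.1.1 t.1.2 ∧ t.2 ∈ t.1.1 ∧ negSet m t.2 = t.2),
    (∏ᶠ X ∈ {X | X ∈ t.1.1 ∧ negSet m X ≠ X ∧ IsRep m X}, a' X.ncard) *
      a'' (t.2.ncard / 2) *
      (∏ᶠ Y ∈ {Y | Y ∈ t.1.2 ∧ negSet m Y ≠ Y ∧ IsRep m Y}, b' Y.ncard))
  +
  (∑ᶠ (t : (Set (Set (Fin (2*m))) × Set (Set (Fin (2*m)))) × Set (Fin (2*m)))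
    (_ : NCBPart m t.1.1 ∧ (¬ ∃ Z ∈ t.1.1, negSet m Z = Z) ∧
         IsKr (2*m) t.1.1 t.1.2 ∧ t.2 ∈ t.1.2 ∧ negSet m t.2 = t.2),
    (∏ᶠ X ∈ {X | X ∈ t.1.1 ∧ negSet m X ≠ X ∧ IsRep m X}, a' X.ncard) *
      b'' (t.2.ncard / 2) *
      (∏ᶠ Y ∈ {Y | Y ∈ t.1.2 ∧ negSet m Y ≠ Y ∧ IsRep m Y}, b' Y.ncard))

/-- An element of `ℂ²`, regarded as an element of the algebra
`C = ℂ[x]/(x²)` (realized as the dual numbers over `ℂ`). -/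
noncomputable def mkD (x y : ℂ) : DualNumber ℂ :=
  TrivSqZeroExt.inl x + TrivSqZeroExt.inr y

/-- A series `Σ_{n ≥ 1} (α_n', α_n'') zⁿ` of `Θ^B` is encoded as the function
`ℕ → ℂ²` sending `k` to the coefficient of `z^(k+1)`.  `boxedB f g` is the boxed
convolution of type B, `f ⊛^B g`. -/
noncomputable def boxedB (f g : ℕ → DualNumber ℂ) : ℕ → DualNumber ℂ :=
  fun k => mkD
    (gammaFst (fun j => (f (j-1)).fst) (fun j => (g (j-1)).fst) (k+1))
    (gammaSnd (fun j => (f (j-1)).fst) (fun j => (f (j-1)).snd)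
              (fun j => (g (j-1)).fst) (fun j => (g (j-1)).snd) (k+1))

/-- The series `Δ'(z) = (1,0) z`. -/
noncomputable def deltaB : ℕ → DualNumber ℂ := fun k => if k = 0 then 1 else 0

/-- The boxed convolution of type A with coefficients in a commutative unital
algebra `C` (series encoded as in `boxedB`: index `k` holds the coefficient
of `z^(k+1)`). -/
noncomputable def boxedA {C : Type*} [CommRing C] (f g : ℕ → C) : ℕ → C :=
  fun k =>
    ∑ᶠ (pq : Set (Set (Fin (k+1))) × Set (Set (Fin (k+1))))
      (_ : NCPart pq.1 ∧ IsKr (k+1) pq.1 pq.2),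
      (∏ᶠ F ∈ pq.1, f (F.ncard - 1)) * (∏ᶠ E ∈ pq.2, g (E.ncard - 1))

end NCPB

namespace NCPB

/-! ### Separation of points on a line and on its double cover -/

/-- The points just after `c` and just after `d` do not separate `a` from `b`. -/
def NonSep (a b c d : ℕ) : Prop := (a ≤ c ↔ b ≤ c) ↔ (a ≤ d ↔ b ≤ d)

/-- The inversion map of `[±m]` on positions. -/
def negNat (m a : ℕ) : ℕ := if a < m then a + m else a - m

/-- The absolute value map of `[±m]` on positions. -/
def absNat (m a : ℕ) : ℕ := if a < m then a else a - m

theorem NonSep.negNat {m a b c d : ℕ} (ha : a < 2 * m) (hb : b < 2 * m) (hc : c < 2 * m)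
    (hd : d < 2 * m) (h : NonSep a b c d) :
    NonSep (negNat m a) (negNat m b) (negNat m c) (negNat m d) := by
  unfold NonSep NCPB.negNat at *
  grind (splits := 40)

theorem NonSep.absNat {m a b c d : ℕ} (ha : a < 2 * m) (hb : b < 2 * m) (h : NonSep a b c d)
    (h' : NonSep (NCPB.negNat m a) (NCPB.negNat m b) c d) :
    NonSep (absNat m a) (absNat m b) (absNat m c) (absNat m d) := by
  unfold NonSep NCPB.negNat NCPB.absNat at *
  grind (splits := 40)

/-- A chord separating `i` from `j` and a chord separating `i` from `-j`, both projecting to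
chords that do not separate `i` from `j`, cross each other. -/
theorem not_nonSep_of_separates {m a b c d i j : ℕ} (ha : a < 2 * m)
    (hc : c < 2 * m) (hd : d < 2 * m) (hi : i < m) (hj : j < m)
    (h₁ : ¬ NonSep a b i j) (h₂ : ¬ NonSep c d i (j + m))
    (h₃ : NonSep (absNat m a) (absNat m b) i j) (h₄ : NonSep (absNat m c) (absNat m d) i j) :
    ¬ NonSep a b c d ∧ ¬ NonSep (absNat m a) (absNat m c) i j := by
  unfold NonSep absNat at *
  grind (splits := 40)

theorem NonSep.of_absNat {m a b c d e : ℕ} (he : e < m)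
    (h₁ : NonSep a b e (e + m)) (h₂ : NonSep c d e (e + m))
    (h : ¬ NonSep a c e (e + m) ∨
      NonSep (NCPB.absNat m a) (NCPB.absNat m b) (NCPB.absNat m c) (NCPB.absNat m d)) :
    NonSep a b c d := by
  unfold NonSep NCPB.absNat at *
  grind (splits := 40)

theorem NonSep.of_absNat_of_ne {m a b c d e : ℕ} (ha : a < 2 * m) (hb : b < 2 * m)
    (he : e < m) (h : NonSep c d e (e + m))
    (hce : NCPB.absNat m c ≠ e) (hde : NCPB.absNat m d ≠ e)
    (hae : NonSep (NCPB.absNat m a) e (NCPB.absNat m c) (NCPB.absNat m d))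
    (hbe : NonSep (NCPB.absNat m b) e (NCPB.absNat m c) (NCPB.absNat m d)) :
    NonSep a b c d := by
  unfold NonSep NCPB.absNat at *
  grind (splits := 40)

theorem NonSep.swap {a b c d : ℕ} (hac : a ≠ c) (had : a ≠ d) (hbc : b ≠ c) (hbd : b ≠ d)
    (h : NonSep a b c d) : NonSep c d a b := by
  unfold NonSep at *
  grind (splits := 40)

/-! ### The inversion and absolute value maps -/

section Maps

variable {m : ℕ}

theorem val_negMap (a : Fin (2 * m)) : (negMap m a).val = negNat m a := by
  have := a.isLt
  change (a.val + m) % (2 * m) = _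
  unfold negNat
  split_ifs with h
  · exact Nat.mod_eq_of_lt (by omega)
  · rw [show a.val + m = (a.val - m) + 2 * m by omega, Nat.add_mod_right]
    exact Nat.mod_eq_of_lt (by omega)

theorem val_absMap (a : Fin (2 * m)) : (absMap m a).val = absNat m a := by
  have := a.isLt
  unfold absMap absNat
  split_ifs with h
  · exact Nat.mod_eq_of_lt h
  · simpa [Nat.mod_eq_sub_mod (not_lt.mp h)] using Nat.mod_eq_of_lt (by omega)

/-- The embedding of `{1, ..., m}` as the positive half of `[±m]`. -/
def posMap (m : ℕ) (i : Fin m) : Fin (2 * m) := ⟨i.val, by have := i.isLt; omega⟩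

@[simp] theorem val_posMap (i : Fin m) : (posMap m i).val = i := rfl

theorem val_negMap_posMap (i : Fin m) : (negMap m (posMap m i)).val = i + m := by
  simp [val_negMap, negNat]

@[simp] theorem negMap_negMap (a : Fin (2 * m)) : negMap m (negMap m a) = a := by
  ext
  have := a.isLt
  simp only [val_negMap, negNat]
  grind

@[simp] theorem absMap_negMap (a : Fin (2 * m)) : absMap m (negMap m a) = absMap m a := by
  ext
  have := a.isLt
  simp only [val_negMap, val_absMap, negNat, absNat]
  grind

@[simp] theorem absMap_posMap (i : Fin m) : absMap m (posMap m i) = i := by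
  ext
  simp [val_absMap, absNat]

theorem eq_or_eq_negMap_of_absMap_eq {a b : Fin (2 * m)} (h : absMap m a = absMap m b) :
    a = b ∨ a = negMap m b := by
  have := congrArg Fin.val h
  have := a.isLt
  have := b.isLt
  simp only [Fin.ext_iff, val_negMap, val_absMap, negNat, absNat] at *
  grind

theorem eq_posMap_or (a : Fin (2 * m)) :
    a = posMap m (absMap m a) ∨ a = negMap m (posMap m (absMap m a)) :=
  eq_or_eq_negMap_of_absMap_eq (by simp)

theorem mem_negSet {X : Set (Fin (2 * m))} {a : Fin (2 * m)} :
    a ∈ negSet m X ↔ negMap m a ∈ X := by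
  constructor
  · rintro ⟨b, hb, rfl⟩
    simpa
  · exact fun h => ⟨_, h, by simp⟩

@[simp] theorem negSet_negSet (X : Set (Fin (2 * m))) : negSet m (negSet m X) = X := by
  ext a
  simp [mem_negSet]

@[simp] theorem absMap_image_negSet (X : Set (Fin (2 * m))) :
    absMap m '' negSet m X = absMap m '' X := by
  simp [negSet, Set.image_image]

theorem absMap_mem_image_iff_of_negSet_eq {X : Set (Fin (2 * m))} (hX : negSet m X = X)
    {a : Fin (2 * m)} : absMap m a ∈ absMap m '' X ↔ a ∈ X := by
  refine ⟨?_, fun h => ⟨a, h, rfl⟩⟩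
  rintro ⟨b, hb, hab⟩
  rcases eq_or_eq_negMap_of_absMap_eq hab with rfl | rfl
  · exact hb
  · rw [← hX, mem_negSet]
    exact hb

theorem ncard_of_negSet_eq {X : Set (Fin (2 * m))} (hX : negSet m X = X) :
    X.ncard = 2 * (absMap m '' X).ncard := by
  set F := absMap m '' X with hF
  have hdec : X = posMap m '' F ∪ (fun i => negMap m (posMap m i)) '' F := by
    ext a
    rw [← absMap_mem_image_iff_of_negSet_eq hX, ← hF]
    constructor
    · intro h
      rcases eq_posMap_or a with h' | h'
      · exact .inl ⟨_, h, h'.symm⟩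
      · exact .inr ⟨_, h, h'.symm⟩
    · rintro (⟨i, hi, rfl⟩ | ⟨i, hi, rfl⟩) <;> simpa using hi
  have hpos : Function.Injective (posMap m) :=
    Function.LeftInverse.injective (g := absMap m) (by intro i; simp)
  have hneg : Function.Injective (fun i => negMap m (posMap m i)) :=
    Function.LeftInverse.injective (g := absMap m) (by intro i; simp)
  rw [hdec, Set.ncard_union_eq, Set.ncard_image_of_injective _ hpos,
    Set.ncard_image_of_injective _ hneg, two_mul]
  rw [Set.disjoint_left]
  rintro _ ⟨i, -, rfl⟩ ⟨j, -, hj⟩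
  have := congrArg Fin.val hj
  have := i.isLt
  simp only [val_negMap_posMap, val_posMap] at *
  omega

end Maps

/-! ### Non-crossing equivalence relations and the Kreweras complement -/

theorem isPartition_classes {α : Type*} (r : Setoid α) : IsPartition r.classes := by
  refine ⟨?_, fun a => Setoid.classes_eqv_classes a⟩
  rintro _ ⟨y, rfl⟩
  exact ⟨y, r.refl' y⟩

theorem exists_classes_eq {α : Type*} {P : Set (Set α)} (hP : IsPartition P) :
    ∃ r : Setoid α, r.classes = P :=
  ⟨Setoid.mkClasses P hP.2,
    Setoid.classes_mkClasses P ⟨fun h => Set.not_nonempty_empty (hP.1 _ h), hP.2⟩⟩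

section Kreweras

variable {n : ℕ}

/-- Chords of distinct classes of `r` do not cross. -/
def NonCrossing (r : Setoid (Fin n)) : Prop :=
  ∀ a b c d : Fin n, r a b → r c d → ¬ r a c → NonSep a b c d

/-- The Kreweras complement: the points just after `c` and just after `d` are equivalent when
no chord of `r` separates them. -/
def kreweras (r : Setoid (Fin n)) : Setoid (Fin n) where
  r c d := ∀ a b : Fin n, r a b → NonSep a b c d
  iseqv :=
    ⟨fun _ _ _ _ => Iff.rfl, fun h a b hab => (h a b hab).symm,
      fun h h' a b hab => (h a b hab).trans (h' a b hab)⟩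

theorem kreweras_apply {r : Setoid (Fin n)} {c d : Fin n} :
    kreweras r c d ↔ ∀ a b : Fin n, r a b → NonSep a b c d := Iff.rfl

theorem isNC_classes_iff (r : Setoid (Fin n)) : IsNC r.classes ↔ NonCrossing r := by
  constructor
  · intro h
    have key : ∀ a b c d : Fin n, a < b → b < c → c < d → r a c → r b d → r a b := by
      intro a b c d hab hbc hcd hac hbd
      exact r.symm' (h _ (r.mem_classes a) _ (r.mem_classes b) a b c d hab hbc hcd (r.refl' a)
        (r.symm' hac) (r.refl' b) (r.symm' hbd))
    intro a b c d hab hcd hac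
    by_contra hsep
    have hba := r.symm' hab
    have hdc := r.symm' hcd
    have hne₁ : a ≠ c := by rintro rfl; exact hac (r.refl' _)
    have hne₂ : a ≠ d := by rintro rfl; exact hac hdc
    have hne₃ : b ≠ c := by rintro rfl; exact hac hab
    have hne₄ : b ≠ d := by rintro rfl; exact hac (r.trans' hab hdc)
    have h₁ : ¬ r c a := fun h => hac (r.symm' h)
    have h₂ : ¬ r a d := fun h => hac (r.trans' h hdc)
    have h₃ : ¬ r b c := fun h => hac (r.trans' hab h)
    have h₄ : ¬ r d a := fun h => h₂ (r.symm' h)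
    have h₅ : ¬ r c b := fun h => h₃ (r.symm' h)
    have h₆ : ¬ r b d := fun h => h₃ (r.trans' h hdc)
    have h₇ : ¬ r d b := fun h => h₆ (r.symm' h)
    have k₁ := key a c b d
    have k₂ := key a d b c
    have k₃ := key b c a d
    have k₄ := key b d a c
    have k₅ := key c a d b
    have k₆ := key c b d a
    have k₇ := key d a c b
    have k₈ := key d b c a
    clear key h
    simp only [Fin.lt_def, ne_eq, Fin.ext_iff, hab, hba, hcd, hdc, hac, h₁, h₂, h₃, h₄, h₅, h₆,
      h₇, forall_true_left, imp_false] at *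
    unfold NonSep at hsep
    grind (splits := 40)
  · rintro h _ ⟨x, rfl⟩ _ ⟨y, rfl⟩ a b c d hab hbc hcd ha hc hb hd
    simp only [Set.mem_ofPred_eq] at *
    by_contra hbx
    have := h a c b d (r.trans' ha (r.symm' hc)) (r.trans' hb (r.symm' hd))
      (fun hr => hbx (r.trans' (r.symm' hr) ha))
    unfold NonSep at this
    simp only [Fin.lt_def] at *
    omega

theorem ncPart_classes_iff (r : Setoid (Fin n)) : NCPart r.classes ↔ NonCrossing r := by
  rw [NCPart, isNC_classes_iff, and_iff_right (isPartition_classes r)]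

theorem nonCrossing_kreweras (r : Setoid (Fin n)) : NonCrossing (kreweras r) := by
  rw [← isNC_classes_iff]
  rintro _ ⟨x, rfl⟩ _ ⟨y, rfl⟩ a b c d hab hbc hcd ha hc hb hd
  simp only [Set.mem_ofPred_eq] at *
  have hac := (kreweras r).trans' ha ((kreweras r).symm' hc)
  have hbd := (kreweras r).trans' hb ((kreweras r).symm' hd)
  refine (kreweras r).trans' (y := a) ?_ ha
  intro u v huv
  have h₁ := hac u v huv
  have h₂ := hbd u v huv
  unfold NonSep at *
  simp only [Fin.lt_def] at *
  grind (splits := 40)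

theorem interleave_isPartition (r s : Setoid (Fin n)) :
    IsPartition (interleave n r.classes s.classes) := by
  constructor
  · rintro _ (⟨B, hB, rfl⟩ | ⟨B, hB, rfl⟩)
    · exact ((isPartition_classes r).1 B hB).image _
    · exact ((isPartition_classes s).1 B hB).image _
  · intro a
    have he : Function.Injective (evens n) := fun i j h => by
      simpa [evens, Fin.ext_iff] using h
    have ho : Function.Injective (odds n) := fun i j h => by
      simpa [odds, Fin.ext_iff] using h
    have heo : ∀ i j, evens n i ≠ odds n j := fun i j h => by
      simp only [evens, odds, Fin.mk.injEq] at h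
      omega
    have ha : (∃ i, a = evens n i) ∨ ∃ i, a = odds n i := by
      have := a.isLt
      rcases Nat.even_or_odd' a.val with ⟨c, hc | hc⟩
      · exact .inl ⟨⟨c, by omega⟩, Fin.ext hc⟩
      · exact .inr ⟨⟨c, by omega⟩, Fin.ext hc⟩
    rcases ha with ⟨i, rfl⟩ | ⟨i, rfl⟩
    · obtain ⟨B, ⟨hB, hi⟩, huniq⟩ := (isPartition_classes r).2 i
      refine ⟨evens n '' B, ⟨.inl ⟨B, hB, rfl⟩, i, hi, rfl⟩, ?_⟩
      rintro _ ⟨⟨C, hC, rfl⟩ | ⟨C, hC, rfl⟩, j, hj, hji⟩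
      · rw [huniq C ⟨hC, he hji ▸ hj⟩]
      · exact absurd hji.symm (heo _ _)
    · obtain ⟨B, ⟨hB, hi⟩, huniq⟩ := (isPartition_classes s).2 i
      refine ⟨odds n '' B, ⟨.inr ⟨B, hB, rfl⟩, i, hi, rfl⟩, ?_⟩
      rintro _ ⟨⟨C, hC, rfl⟩ | ⟨C, hC, rfl⟩, j, hj, hji⟩
      · exact absurd hji (heo _ _)
      · rw [huniq C ⟨hC, ho hji ▸ hj⟩]

theorem le_kreweras_of_interleave {r s : Setoid (Fin n)}
    (h : IsNC (interleave n r.classes s.classes)) : s ≤ kreweras r := by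
  have hr : ∀ a, evens n '' {x | r x a} ∈ interleave n r.classes s.classes :=
    fun a => .inl ⟨_, r.mem_classes a, rfl⟩
  have hs : ∀ a, odds n '' {x | s x a} ∈ interleave n r.classes s.classes :=
    fun a => .inr ⟨_, s.mem_classes a, rfl⟩
  have key₁ : ∀ a b c d : Fin n, r a c → s b d → a ≤ b → b < c → c ≤ d → False := by
    intro a b c d hac hbd hab hbc hcd
    simp only [Fin.lt_def, Fin.le_def] at *
    obtain ⟨x, -, hx⟩ := h _ (hr a) _ (hs b) (evens n a) (odds n b) (evens n c) (odds n d)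
      (by simp only [evens, odds, Fin.mk_lt_mk]; omega)
      (by simp only [evens, odds, Fin.mk_lt_mk]; omega)
      (by simp only [evens, odds, Fin.mk_lt_mk]; omega)
      ⟨a, r.refl' a, rfl⟩ ⟨c, r.symm' hac, rfl⟩ ⟨b, s.refl' b, rfl⟩ ⟨d, s.symm' hbd, rfl⟩
    simp only [evens, odds, Fin.mk.injEq] at hx
    omega
  have key₂ : ∀ a b c d : Fin n, s a c → r b d → a < b → b ≤ c → c < d → False := by
    intro a b c d hac hbd hab hbc hcd
    simp only [Fin.lt_def, Fin.le_def] at *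
    obtain ⟨x, -, hx⟩ := h _ (hs a) _ (hr b) (odds n a) (evens n b) (odds n c) (evens n d)
      (by simp only [evens, odds, Fin.mk_lt_mk]; omega)
      (by simp only [evens, odds, Fin.mk_lt_mk]; omega)
      (by simp only [evens, odds, Fin.mk_lt_mk]; omega)
      ⟨a, s.refl' a, rfl⟩ ⟨c, s.symm' hac, rfl⟩ ⟨b, r.refl' b, rfl⟩ ⟨d, r.symm' hbd, rfl⟩
    simp only [evens, odds, Fin.mk.injEq] at hx
    omega
  intro c d hcd a b hab
  have hdc := s.symm' hcd
  have hba := r.symm' hab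
  have k₁ := key₁ a c b d hab hcd
  have k₂ := key₁ a d b c hab hdc
  have k₃ := key₁ b c a d hba hcd
  have k₄ := key₁ b d a c hba hdc
  have k₅ := key₂ c a d b hcd hab
  have k₆ := key₂ c b d a hcd hba
  have k₇ := key₂ d a c b hdc hab
  have k₈ := key₂ d b c a hdc hba
  simp only [Fin.lt_def, Fin.le_def] at *
  clear key₁ key₂ hr hs h
  unfold NonSep
  grind (splits := 40)

theorem ncPart_interleave_of_le_kreweras {r s : Setoid (Fin n)} (hr : NonCrossing r)
    (hs : NonCrossing s) (h : s ≤ kreweras r) : NCPart (interleave n r.classes s.classes) := by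
  refine ⟨interleave_isPartition r s, ?_⟩
  rintro _ (⟨B, hB, rfl⟩ | ⟨B, hB, rfl⟩) _ (⟨C, hC, rfl⟩ | ⟨C, hC, rfl⟩) _ _ _ _ hab hbc hcd
    ⟨a, ha, rfl⟩ ⟨c, hc, rfl⟩ ⟨b, hb, rfl⟩ ⟨d, hd, rfl⟩
  · refine ⟨b, ?_, rfl⟩
    simp only [evens, Fin.mk_lt_mk] at *
    exact (isNC_classes_iff r).2 hr B hB C hC a b c d (by rw [Fin.lt_def]; omega)
      (by rw [Fin.lt_def]; omega) (by rw [Fin.lt_def]; omega) ha hc hb hd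
  · obtain ⟨x, rfl⟩ := hB
    obtain ⟨y, rfl⟩ := hC
    have := h (s.trans' hb (s.symm' hd)) a c (r.trans' ha (r.symm' hc))
    simp only [evens, odds, Fin.mk_lt_mk] at *
    unfold NonSep at this
    omega
  · obtain ⟨x, rfl⟩ := hB
    obtain ⟨y, rfl⟩ := hC
    have := h (s.trans' ha (s.symm' hc)) b d (r.trans' hb (r.symm' hd))
    simp only [evens, odds, Fin.mk_lt_mk] at *
    unfold NonSep at this
    omega
  · refine ⟨b, ?_, rfl⟩
    simp only [odds, Fin.mk_lt_mk] at *
    exact (isNC_classes_iff s).2 hs B hB C hC a b c d (by rw [Fin.lt_def]; omega)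
      (by rw [Fin.lt_def]; omega) (by rw [Fin.lt_def]; omega) ha hc hb hd

theorem isKr_classes_iff {r : Setoid (Fin n)} (hr : NonCrossing r) {q : Set (Set (Fin n))} :
    IsKr n r.classes q ↔ q = (kreweras r).classes := by
  have hK := nonCrossing_kreweras r
  constructor
  · rintro ⟨hq, hi, hmax⟩
    obtain ⟨s, rfl⟩ := exists_classes_eq hq.1
    have hle := le_kreweras_of_interleave hi.2
    have href := hmax _ ((ncPart_classes_iff _).2 hK)
      (ncPart_interleave_of_le_kreweras hr hK le_rfl)
    congr 1
    refine le_antisymm hle fun a b hab => ?_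
    obtain ⟨_, ⟨c, rfl⟩, hc⟩ := href _ ((kreweras r).mem_classes b)
    exact s.trans' (hc hab) (s.symm' (hc ((kreweras r).refl' b)))
  · rintro rfl
    refine ⟨(ncPart_classes_iff _).2 hK, ncPart_interleave_of_le_kreweras hr hK le_rfl, ?_⟩
    intro q' hq' hi
    obtain ⟨s, rfl⟩ := exists_classes_eq hq'.1
    have hle := le_kreweras_of_interleave hi.2
    rintro _ ⟨x, rfl⟩
    exact ⟨_, (kreweras r).mem_classes x, fun y hy => hle hy⟩

end Kreweras

/-! ### Inversion-invariant equivalence relations on `[±m]` -/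

section Invariant

variable {m : ℕ}

/-- Invariance of an equivalence relation on `[±m]` under inversion. -/
def NegInvariant (R : Setoid (Fin (2 * m))) : Prop :=
  ∀ a b, R a b → R (negMap m a) (negMap m b)

theorem NegInvariant.negMap_left {R : Setoid (Fin (2 * m))} (hR : NegInvariant R)
    {a b : Fin (2 * m)} : R (negMap m a) b ↔ R a (negMap m b) :=
  ⟨fun h => by simpa using hR _ _ h, fun h => by simpa using hR _ _ h⟩

/-- The equivalence relation on `{1, ..., m}` whose classes are the absolute values of the
classes of an invariant equivalence relation. -/
def absSetoid (R : Setoid (Fin (2 * m))) (hR : NegInvariant R) : Setoid (Fin m) where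
  r i j := ∃ a b, R a b ∧ absMap m a = i ∧ absMap m b = j
  iseqv := by
    refine ⟨fun i => ⟨posMap m i, posMap m i, R.refl' _, by simp⟩, ?_, ?_⟩
    · rintro i j ⟨a, b, h, rfl, rfl⟩
      exact ⟨b, a, R.symm' h, rfl, rfl⟩
    · rintro i j k ⟨a, b, h, rfl, rfl⟩ ⟨b', c, h', hb, rfl⟩
      rcases eq_or_eq_negMap_of_absMap_eq hb with rfl | rfl
      · exact ⟨a, c, R.trans' h h', rfl, rfl⟩
      · exact ⟨a, negMap m c, R.trans' h (hR.negMap_left.1 h'), rfl, by simp⟩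

theorem absSetoid_of_rel {R : Setoid (Fin (2 * m))} (hR : NegInvariant R)
    {a b : Fin (2 * m)} (h : R a b) : absSetoid R hR (absMap m a) (absMap m b) :=
  ⟨a, b, h, rfl, rfl⟩

theorem absSetoid_iff {R : Setoid (Fin (2 * m))} (hR : NegInvariant R) {a b : Fin (2 * m)} :
    absSetoid R hR (absMap m a) (absMap m b) ↔ R a b ∨ R a (negMap m b) := by
  constructor
  · rintro ⟨c, d, h, hc, hd⟩
    rcases eq_or_eq_negMap_of_absMap_eq hc with rfl | rfl <;>
      rcases eq_or_eq_negMap_of_absMap_eq hd with rfl | rfl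
    · exact .inl h
    · exact .inr h
    · exact .inr (hR.negMap_left.1 h)
    · exact .inl (by simpa using hR _ _ h)
  · rintro (h | h)
    · exact absSetoid_of_rel hR h
    · simpa using absSetoid_of_rel hR h

theorem image_absMap_class {R : Setoid (Fin (2 * m))} (hR : NegInvariant R)
    (z : Fin (2 * m)) :
    absMap m '' {x | R x z} = {i | absSetoid R hR i (absMap m z)} := by
  ext i
  constructor
  · rintro ⟨x, hx, rfl⟩
    exact absSetoid_of_rel hR hx
  · intro hi
    obtain ⟨x, rfl⟩ : ∃ x, absMap m x = i := ⟨posMap m i, by simp⟩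
    rcases (absSetoid_iff hR).1 hi with h | h
    · exact ⟨x, h, rfl⟩
    · exact ⟨negMap m x, hR.negMap_left.2 h, by simp⟩

theorem absPart_classes {R : Setoid (Fin (2 * m))} (hR : NegInvariant R) :
    absPart m R.classes = (absSetoid R hR).classes := by
  ext F
  constructor
  · rintro ⟨_, ⟨z, rfl⟩, rfl⟩
    exact ⟨absMap m z, image_absMap_class hR z⟩
  · rintro ⟨i, rfl⟩
    refine ⟨_, R.mem_classes (posMap m i), ?_⟩
    rw [image_absMap_class hR, absMap_posMap]

theorem negSet_class {R : Setoid (Fin (2 * m))} (hR : NegInvariant R) (z : Fin (2 * m)) :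
    negSet m {x | R x z} = {x | R x (negMap m z)} := by
  ext x
  rw [mem_negSet]
  exact hR.negMap_left

theorem negSet_class_eq_iff {R : Setoid (Fin (2 * m))} (hR : NegInvariant R)
    {z : Fin (2 * m)} : negSet m {x | R x z} = {x | R x z} ↔ R z (negMap m z) := by
  rw [negSet_class hR]
  constructor
  · intro h
    exact (Set.ext_iff.1 h z).2 (R.refl' z)
  · intro h
    ext x
    exact ⟨fun hx => R.trans' hx (R.symm' h), fun hx => R.trans' hx h⟩

theorem ncbPart_classes_iff (R : Setoid (Fin (2 * m))) :
    NCBPart m R.classes ↔ NonCrossing R ∧ NegInvariant R := by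
  rw [NCBPart, ncPart_classes_iff]
  refine and_congr_right fun _ => ⟨fun h a b hab => ?_, fun h => ?_⟩
  · refine (Setoid.rel_iff_exists_classes R).2 ⟨_, h _ (R.mem_classes b), ?_, ?_⟩
    · exact ⟨a, hab, rfl⟩
    · exact ⟨b, R.refl' b, rfl⟩
  · rintro _ ⟨z, rfl⟩
    rw [negSet_class h]
    exact R.mem_classes _

theorem NegInvariant.kreweras {R : Setoid (Fin (2 * m))} (hR : NegInvariant R) :
    NegInvariant (kreweras R) := by
  intro c d h a b hab
  have := (h _ _ (hR _ _ hab)).negNat (negMap m a).isLt (negMap m b).isLt c.isLt d.isLt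
  simpa only [← val_negMap, negMap_negMap] using this

theorem NonCrossing.absSetoid {R : Setoid (Fin (2 * m))} (hnc : NonCrossing R)
    (hR : NegInvariant R) : NonCrossing (absSetoid R hR) := by
  rintro _ _ _ _ ⟨a, b, hab, rfl, rfl⟩ ⟨c, d, hcd, rfl, rfl⟩ hac
  rw [absSetoid_iff, not_or, ← hR.negMap_left] at hac
  have h₁ := hnc a b c d hab hcd hac.1
  have h₂ := hnc _ _ c d (hR _ _ hab) hcd hac.2
  rw [val_negMap, val_negMap] at h₂
  simpa only [val_absMap] using h₁.absNat a.isLt b.isLt h₂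

theorem absSetoid_kreweras {R : Setoid (Fin (2 * m))} (hnc : NonCrossing R)
    (hR : NegInvariant R) :
    absSetoid (kreweras R) hR.kreweras = kreweras (absSetoid R hR) := by
  ext i j
  constructor
  · rintro ⟨c, d, hcd, rfl, rfl⟩ _ _ ⟨a, b, hab, rfl, rfl⟩
    have h₁ := hcd a b hab
    have h₂ := hcd _ _ (hR _ _ hab)
    rw [val_negMap, val_negMap] at h₂
    simpa only [val_absMap] using h₁.absNat a.isLt b.isLt h₂
  · intro hij
    rw [← absMap_posMap i, ← absMap_posMap j, absSetoid_iff]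
    by_contra! hcon
    simp only [kreweras_apply, not_forall] at hcon
    obtain ⟨⟨a, b, hab, h₁⟩, c, d, hcd, h₂⟩ := hcon
    rw [val_negMap_posMap] at h₂
    have hsep : ∀ x y, R x y → NonSep (absNat m x) (absNat m y) i j := by
      intro x y hxy
      simpa only [val_absMap] using hij _ _ (absSetoid_of_rel hR hxy)
    obtain ⟨h₃, h₄⟩ := not_nonSep_of_separates a.isLt c.isLt d.isLt i.isLt j.isLt h₁ h₂
      (hsep _ _ hab) (hsep _ _ hcd)
    exact h₄ (hsep _ _ (by_contra fun hac => h₃ (hnc _ _ _ _ hab hcd hac)))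

/-! ### The lift of a non-crossing partition with prescribed zero-block -/

/-- The points `a` and `b` are on the same side of the diameter joining the points just after
`e` and just after `-e`. -/
def SameSide (e : Fin m) (a b : Fin (2 * m)) : Prop := NonSep a b e (e + m)

theorem SameSide.refl (e : Fin m) (a : Fin (2 * m)) : SameSide e a a := by
  simp [SameSide, NonSep]

theorem SameSide.symm {e : Fin m} {a b : Fin (2 * m)} (h : SameSide e a b) :
    SameSide e b a := by
  simp only [SameSide, NonSep] at *
  tauto

theorem SameSide.trans {e : Fin m} {a b c : Fin (2 * m)} (h : SameSide e a b)
    (h' : SameSide e b c) : SameSide e a c := by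
  simp only [SameSide, NonSep] at *
  tauto

theorem sameSide_negMap_right {e : Fin m} {a b : Fin (2 * m)} :
    SameSide e a (negMap m b) ↔ ¬ SameSide e a b := by
  have := a.isLt
  have := b.isLt
  have := e.isLt
  simp only [SameSide, NonSep, val_negMap, negNat]
  grind (splits := 40)

theorem SameSide.negMap {e : Fin m} {a b : Fin (2 * m)} (h : SameSide e a b) :
    SameSide e (negMap m a) (negMap m b) := by
  rw [sameSide_negMap_right]
  intro h'
  exact sameSide_negMap_right.1 h'.symm h.symm

theorem kreweras_posMap_negMap_iff {R : Setoid (Fin (2 * m))} {e : Fin m} :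
    kreweras R (posMap m e) (negMap m (posMap m e)) ↔ ∀ a b, R a b → SameSide e a b := by
  simp only [kreweras_apply, val_negMap_posMap, val_posMap, SameSide]

/-- The lift to `[±m]` of an equivalence relation on `{1, ..., m}` without zero-block and with
the class of `e` in the Kreweras complement lifted to a zero-block. -/
def splitLift (r : Setoid (Fin m)) (e : Fin m) : Setoid (Fin (2 * m)) where
  r a b := r (absMap m a) (absMap m b) ∧ SameSide e a b
  iseqv :=
    ⟨fun _ => ⟨r.refl' _, .refl e _⟩, fun h => ⟨r.symm' h.1, h.2.symm⟩,
      fun h h' => ⟨r.trans' h.1 h'.1, h.2.trans h'.2⟩⟩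

/-- The lift to `[±m]` of an equivalence relation on `{1, ..., m}` in which the class of `f` is
lifted to a zero-block. -/
def zeroLift (r : Setoid (Fin m)) (f : Fin m) : Setoid (Fin (2 * m)) where
  r a b := r (absMap m a) (absMap m b) ∧ (r (absMap m a) f ∨ SameSide f a b)
  iseqv :=
    ⟨fun _ => ⟨r.refl' _, .inr (.refl f _)⟩,
      fun h => ⟨r.symm' h.1, h.2.imp (r.trans' (r.symm' h.1)) SameSide.symm⟩,
      fun h h' => ⟨r.trans' h.1 h'.1, by
        rcases h.2 with h₂ | h₂
        · exact .inl h₂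
        · exact h'.2.imp (r.trans' h.1) h₂.trans⟩⟩

theorem splitLift_apply {r : Setoid (Fin m)} {e : Fin m} {a b : Fin (2 * m)} :
    splitLift r e a b ↔ r (absMap m a) (absMap m b) ∧ SameSide e a b := Iff.rfl

theorem zeroLift_apply {r : Setoid (Fin m)} {f : Fin m} {a b : Fin (2 * m)} :
    zeroLift r f a b ↔
      r (absMap m a) (absMap m b) ∧ (r (absMap m a) f ∨ SameSide f a b) := Iff.rfl

theorem negInvariant_splitLift (r : Setoid (Fin m)) (e : Fin m) :
    NegInvariant (splitLift r e) := by
  intro a b h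
  rw [splitLift_apply] at *
  simpa using ⟨h.1, h.2.negMap⟩

theorem negInvariant_zeroLift (r : Setoid (Fin m)) (f : Fin m) :
    NegInvariant (zeroLift r f) := by
  intro a b h
  rw [zeroLift_apply] at *
  simpa using ⟨h.1, h.2.imp_right SameSide.negMap⟩

theorem absSetoid_splitLift (r : Setoid (Fin m)) (e : Fin m) :
    absSetoid (splitLift r e) (negInvariant_splitLift r e) = r := by
  ext i j
  rw [← absMap_posMap i, ← absMap_posMap j, absSetoid_iff, splitLift_apply, splitLift_apply,
    sameSide_negMap_right, absMap_negMap]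
  tauto

theorem absSetoid_zeroLift (r : Setoid (Fin m)) (f : Fin m) :
    absSetoid (zeroLift r f) (negInvariant_zeroLift r f) = r := by
  ext i j
  rw [← absMap_posMap i, ← absMap_posMap j, absSetoid_iff, zeroLift_apply, zeroLift_apply,
    sameSide_negMap_right, absMap_negMap]
  tauto

theorem zeroLift_self (r : Setoid (Fin m)) (f : Fin m) :
    zeroLift r f (posMap m f) (negMap m (posMap m f)) := by
  simp [zeroLift_apply]

theorem kreweras_splitLift_self (r : Setoid (Fin m)) (e : Fin m) :
    kreweras (splitLift r e) (posMap m e) (negMap m (posMap m e)) :=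
  kreweras_posMap_negMap_iff.2 fun _ _ h => h.2

theorem nonSep_of_sameSide {r : Setoid (Fin m)} (hr : NonCrossing r) {e : Fin m}
    {a b c d : Fin (2 * m)} (hab : r (absMap m a) (absMap m b))
    (hcd : r (absMap m c) (absMap m d)) (hab' : SameSide e a b) (hcd' : SameSide e c d)
    (hac : ¬ (r (absMap m a) (absMap m c) ∧ SameSide e a c)) : NonSep a b c d := by
  refine NonSep.of_absNat e.isLt hab' hcd' ?_
  by_cases h : SameSide e a c
  · right
    simpa only [val_absMap] using hr _ _ _ _ hab hcd fun h' => hac ⟨h', h⟩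
  · exact .inl h

theorem nonCrossing_splitLift {r : Setoid (Fin m)} (hr : NonCrossing r) (e : Fin m) :
    NonCrossing (splitLift r e) :=
  fun _ _ _ _ hab hcd hac => nonSep_of_sameSide hr hab.1 hcd.1 hab.2 hcd.2 hac

theorem nonSep_of_rel_of_sameSide {r : Setoid (Fin m)} (hr : NonCrossing r) {f : Fin m}
    {a b c d : Fin (2 * m)} (haf : r (absMap m a) f) (hbf : r (absMap m b) f)
    (hcd : r (absMap m c) (absMap m d)) (hcf : ¬ r (absMap m c) f)
    (h : SameSide f c d) : NonSep a b c d := by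
  have hdf : ¬ r (absMap m d) f := fun h' => hcf (r.trans' hcd h')
  have key : ∀ x, r x f → NonSep x f (absMap m c) (absMap m d) := fun x hx =>
    hr _ _ _ _ hx hcd fun h' => hcf (r.trans' (r.symm' h') hx)
  refine NonSep.of_absNat_of_ne a.isLt b.isLt f.isLt h ?_ ?_ ?_ ?_
  · rw [← val_absMap, ne_eq, ← Fin.ext_iff]
    exact fun h' => hcf (h' ▸ r.refl' _)
  · rw [← val_absMap, ne_eq, ← Fin.ext_iff]
    exact fun h' => hdf (h' ▸ r.refl' _)
  · simpa only [val_absMap] using key _ haf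
  · simpa only [val_absMap] using key _ hbf

theorem nonCrossing_zeroLift {r : Setoid (Fin m)} (hr : NonCrossing r) (f : Fin m) :
    NonCrossing (zeroLift r f) := by
  rintro a b c d ⟨hab, hab'⟩ ⟨hcd, hcd'⟩ hac
  rw [zeroLift_apply] at hac
  have hne : ∀ x y : Fin (2 * m), ¬ r (absMap m x) (absMap m y) → (x : ℕ) ≠ y := by
    intro x y h h'
    exact h (Fin.ext h' ▸ r.refl' _)
  by_cases haf : r (absMap m a) f
  · have hcf : ¬ r (absMap m c) f := fun h => hac ⟨r.trans' haf (r.symm' h), .inl haf⟩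
    exact nonSep_of_rel_of_sameSide hr haf (r.trans' (r.symm' hab) haf) hcd hcf
      (hcd'.resolve_left hcf)
  · have hab'' := hab'.resolve_left haf
    by_cases hcf : r (absMap m c) f
    · have hac' : ¬ r (absMap m c) (absMap m a) := fun h => haf (r.trans' (r.symm' h) hcf)
      have hbc : ¬ r (absMap m c) (absMap m b) :=
        fun h => hac' (r.trans' h (r.symm' hab))
      have had : ¬ r (absMap m d) (absMap m a) := fun h => hac' (r.trans' hcd h)
      have hbd : ¬ r (absMap m d) (absMap m b) := fun h => hbc (r.trans' hcd h)
      exact (nonSep_of_rel_of_sameSide hr hcf (r.trans' (r.symm' hcd) hcf) hab haf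
        hab'').swap (hne _ _ hac') (hne _ _ hbc) (hne _ _ had) (hne _ _ hbd)
    · exact nonSep_of_sameSide hr hab hcd hab'' (hcd'.resolve_left hcf)
        fun h => hac ⟨h.1, .inr h.2⟩

theorem eq_splitLift {R : Setoid (Fin (2 * m))} (hR : NegInvariant R) {e : Fin m}
    (he : kreweras R (posMap m e) (negMap m (posMap m e))) :
    R = splitLift (absSetoid R hR) e := by
  rw [kreweras_posMap_negMap_iff] at he
  ext a b
  rw [splitLift_apply, absSetoid_iff]
  refine ⟨fun h => ⟨.inl h, he _ _ h⟩, ?_⟩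
  rintro ⟨h | h, h'⟩
  · exact h
  · exact absurd h' (sameSide_negMap_right.1 (he _ _ h))

theorem eq_zeroLift {R : Setoid (Fin (2 * m))} (hnc : NonCrossing R) (hR : NegInvariant R)
    {f : Fin m} (hf : R (posMap m f) (negMap m (posMap m f))) :
    R = zeroLift (absSetoid R hR) f := by
  have key : ∀ a b, R a b → ¬ R a (posMap m f) → SameSide f a b := by
    intro a b hab haf
    simpa only [SameSide, val_negMap_posMap, val_posMap] using hnc _ _ _ _ hab hf haf
  have habs : ∀ a, absSetoid R hR (absMap m a) f ↔ R a (posMap m f) := by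
    intro a
    nth_rewrite 1 [← absMap_posMap f]
    rw [absSetoid_iff]
    exact ⟨fun h => h.elim id fun h => R.trans' h (R.symm' hf), .inl⟩
  ext a b
  rw [zeroLift_apply, absSetoid_iff, habs]
  constructor
  · intro h
    exact ⟨.inl h, or_iff_not_imp_left.2 (key _ _ h)⟩
  · rintro ⟨h | h, h'⟩
    · exact h
    · by_cases haf : R a (posMap m f)
      · have hbf := hR.negMap_left.1 (R.trans' (R.symm' h) haf)
        exact R.trans' haf (R.trans' hf (R.symm' hbf))
      · exact absurd (h'.resolve_left haf) (sameSide_negMap_right.1 (key _ _ h haf))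

theorem rel_of_rel_negMap {R : Setoid (Fin (2 * m))} (hnc : NonCrossing R)
    {a c : Fin (2 * m)} (ha : R a (negMap m a)) (hc : R c (negMap m c)) : R a c := by
  by_contra h
  have := hnc _ _ _ _ ha hc h
  have hne : a.val ≠ c.val := fun h' => h (Fin.ext h' ▸ R.refl' _)
  have := a.isLt
  have := c.isLt
  simp only [NonSep, val_negMap, negNat] at *
  grind (splits := 40)

theorem not_kreweras_negMap {R : Setoid (Fin (2 * m))} {a c : Fin (2 * m)}
    (ha : R a (negMap m a)) : ¬ kreweras R c (negMap m c) := by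
  intro h
  have := h _ _ ha
  have := a.isLt
  have := c.isLt
  simp only [NonSep, val_negMap, negNat] at *
  grind (splits := 40)

end Invariant

/-! ### The bijections given by the absolute value map -/

section Bijection

variable {m : ℕ}

theorem posMap_rel_negMap_iff {R : Setoid (Fin (2 * m))} (hR : NegInvariant R)
    {z : Fin (2 * m)} :
    R (posMap m (absMap m z)) (negMap m (posMap m (absMap m z))) ↔ R z (negMap m z) := by
  rcases eq_posMap_or z with h | h
  · rw [← h]
  · rw [← hR.negMap_left, ← h, ← negMap_negMap (posMap m (absMap m z)), ← h]

/-- A non-crossing partition with its Kreweras complement and a subset, sent to the absolute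
values. -/
def absTriple (m : ℕ)
    (t : (Set (Set (Fin (2 * m))) × Set (Set (Fin (2 * m)))) × Set (Fin (2 * m))) :
    (Set (Set (Fin m)) × Set (Set (Fin m))) × Set (Fin m) :=
  ((absPart m t.1.1, absPart m t.1.2), absMap m '' t.2)

theorem exists_of_ncbPart {π κ : Set (Set (Fin (2 * m)))}
    (hπ : NCBPart m π) (hκ : IsKr (2 * m) π κ) :
    ∃ R : Setoid (Fin (2 * m)), NonCrossing R ∧ NegInvariant R ∧ π = R.classes ∧
      κ = (kreweras R).classes := by
  obtain ⟨R, rfl⟩ := exists_classes_eq hπ.1.1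
  obtain ⟨hnc, hR⟩ := (ncbPart_classes_iff R).1 hπ
  exact ⟨R, hnc, hR, rfl, (isKr_classes_iff hnc).1 hκ⟩

theorem absTriple_classes {R : Setoid (Fin (2 * m))} (hnc : NonCrossing R)
    (hR : NegInvariant R) (Z : Set (Fin (2 * m))) :
    absTriple m ((R.classes, (kreweras R).classes), Z) =
      (((absSetoid R hR).classes, (kreweras (absSetoid R hR)).classes), absMap m '' Z) := by
  rw [absTriple, absPart_classes hR, absPart_classes hR.kreweras, absSetoid_kreweras hnc hR]

theorem ncPart_and_isKr_of_nonCrossing {r : Setoid (Fin m)} (hr : NonCrossing r) :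
    NCPart r.classes ∧ IsKr m r.classes (kreweras r).classes :=
  ⟨(ncPart_classes_iff r).2 hr, (isKr_classes_iff hr).2 rfl⟩

theorem exists_of_ncPart {p q : Set (Set (Fin m))} (hp : NCPart p) (hq : IsKr m p q) :
    ∃ r : Setoid (Fin m), NonCrossing r ∧ p = r.classes ∧ q = (kreweras r).classes := by
  obtain ⟨r, rfl⟩ := exists_classes_eq hp.1
  have hr := (ncPart_classes_iff r).1 hp
  exact ⟨r, hr, rfl, (isKr_classes_iff hr).1 hq⟩

theorem posMap_rel_of_mem_image {R : Setoid (Fin (2 * m))} (hR : NegInvariant R)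
    {z : Fin (2 * m)} (hz : R z (negMap m z)) {i : Fin m}
    (hi : i ∈ absMap m '' {x | R x z}) : R (posMap m i) (negMap m (posMap m i)) := by
  obtain ⟨x, hx, rfl⟩ := hi
  exact (posMap_rel_negMap_iff hR).2
    (R.trans' hx (R.trans' hz (R.symm' (hR _ _ hx))))

theorem eq_of_absMap_image_eq {X Y : Set (Fin (2 * m))} (hX : negSet m X = X)
    (hY : negSet m Y = Y) (h : absMap m '' X = absMap m '' Y) : X = Y := by
  ext a
  rw [← absMap_mem_image_iff_of_negSet_eq hX, h, absMap_mem_image_iff_of_negSet_eq hY]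

theorem bijOn_absTriple_zeroBlock :
    Set.BijOn (absTriple m)
      {t | NCBPart m t.1.1 ∧ IsKr (2 * m) t.1.1 t.1.2 ∧ t.2 ∈ t.1.1 ∧ negSet m t.2 = t.2}
      {t | (NCPart t.1.1 ∧ IsKr m t.1.1 t.1.2) ∧ t.2 ∈ t.1.1} := by
  refine ⟨?_, ?_, ?_⟩
  · rintro ⟨⟨π, κ⟩, Z⟩ ⟨hπ, hκ, hZ, hZZ⟩
    obtain ⟨R, hnc, hR, rfl, rfl⟩ := exists_of_ncbPart hπ hκ
    obtain ⟨z, rfl⟩ := hZ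
    rw [absTriple_classes hnc hR, image_absMap_class hR]
    exact ⟨ncPart_and_isKr_of_nonCrossing (hnc.absSetoid hR), Setoid.mem_classes _ _⟩
  · rintro ⟨⟨π, κ⟩, Z⟩ ⟨hπ, hκ, hZ, hZZ⟩ ⟨⟨π', κ'⟩, Z'⟩ ⟨hπ', hκ', hZ', hZZ'⟩ heq
    obtain ⟨R, hnc, hR, rfl, rfl⟩ := exists_of_ncbPart hπ hκ
    obtain ⟨R', hnc', hR', rfl, rfl⟩ := exists_of_ncbPart hπ' hκ'
    obtain ⟨z, rfl⟩ := hZ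
    obtain ⟨z', rfl⟩ := hZ'
    rw [absTriple_classes hnc hR, absTriple_classes hnc' hR'] at heq
    simp only [Prod.mk.injEq] at heq hZZ hZZ'
    have hr := Setoid.classes_inj.2 heq.1.1
    have hmem : absMap m z ∈ absMap m '' {x | R x z} := ⟨z, R.refl' z, rfl⟩
    have h₁ := eq_zeroLift hnc hR
      (posMap_rel_of_mem_image hR ((negSet_class_eq_iff hR).1 hZZ) hmem)
    have h₂ := eq_zeroLift hnc' hR'
      (posMap_rel_of_mem_image hR' ((negSet_class_eq_iff hR').1 hZZ') (heq.2 ▸ hmem))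
    have hRR : R = R' := by rw [h₁, h₂, hr]
    rw [eq_of_absMap_image_eq hZZ hZZ' heq.2, hRR]
  · rintro ⟨⟨p, q⟩, F⟩ ⟨⟨hp, hq⟩, hF⟩
    obtain ⟨r, hr, rfl, rfl⟩ := exists_of_ncPart hp hq
    obtain ⟨f, rfl⟩ := hF
    have hnc := nonCrossing_zeroLift hr f
    have hR := negInvariant_zeroLift r f
    refine ⟨(((zeroLift r f).classes, (kreweras (zeroLift r f)).classes),
        {x | zeroLift r f x (posMap m f)}),
      ⟨(ncbPart_classes_iff _).2 ⟨hnc, hR⟩, (isKr_classes_iff hnc).2 rfl,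
        Setoid.mem_classes _ _, (negSet_class_eq_iff hR).2 (zeroLift_self r f)⟩, ?_⟩
    rw [absTriple_classes hnc hR, image_absMap_class hR]
    rw [absSetoid_zeroLift, absMap_posMap]

theorem bijOn_absTriple_kreweras_zeroBlock :
    Set.BijOn (absTriple m)
      {t | NCBPart m t.1.1 ∧ (¬ ∃ Z ∈ t.1.1, negSet m Z = Z) ∧ IsKr (2 * m) t.1.1 t.1.2 ∧
        t.2 ∈ t.1.2 ∧ negSet m t.2 = t.2}
      {t | (NCPart t.1.1 ∧ IsKr m t.1.1 t.1.2) ∧ t.2 ∈ t.1.2} := by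
  refine ⟨?_, ?_, ?_⟩
  · rintro ⟨⟨π, κ⟩, Z⟩ ⟨hπ, -, hκ, hZ, hZZ⟩
    obtain ⟨R, hnc, hR, rfl, rfl⟩ := exists_of_ncbPart hπ hκ
    obtain ⟨z, rfl⟩ := hZ
    rw [absTriple_classes hnc hR, image_absMap_class hR.kreweras, absSetoid_kreweras hnc hR]
    exact ⟨ncPart_and_isKr_of_nonCrossing (hnc.absSetoid hR), Setoid.mem_classes _ _⟩
  · rintro ⟨⟨π, κ⟩, Z⟩ ⟨hπ, -, hκ, hZ, hZZ⟩ ⟨⟨π', κ'⟩, Z'⟩ ⟨hπ', -, hκ', hZ', hZZ'⟩ heq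
    obtain ⟨R, hnc, hR, rfl, rfl⟩ := exists_of_ncbPart hπ hκ
    obtain ⟨R', hnc', hR', rfl, rfl⟩ := exists_of_ncbPart hπ' hκ'
    obtain ⟨z, rfl⟩ := hZ
    obtain ⟨z', rfl⟩ := hZ'
    rw [absTriple_classes hnc hR, absTriple_classes hnc' hR'] at heq
    simp only [Prod.mk.injEq] at heq hZZ hZZ'
    have hr := Setoid.classes_inj.2 heq.1.1
    have hmem : absMap m z ∈ absMap m '' {x | kreweras R x z} :=
      ⟨z, (kreweras R).refl' z, rfl⟩
    have h₁ := eq_splitLift hR (posMap_rel_of_mem_image hR.kreweras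
      ((negSet_class_eq_iff hR.kreweras).1 hZZ) hmem)
    have h₂ := eq_splitLift hR' (posMap_rel_of_mem_image hR'.kreweras
      ((negSet_class_eq_iff hR'.kreweras).1 hZZ') (heq.2 ▸ hmem))
    have hRR : R = R' := by rw [h₁, h₂, hr]
    rw [eq_of_absMap_image_eq hZZ hZZ' heq.2, hRR]
  · rintro ⟨⟨p, q⟩, F⟩ ⟨⟨hp, hq⟩, hF⟩
    obtain ⟨r, hr, rfl, rfl⟩ := exists_of_ncPart hp hq
    obtain ⟨e, rfl⟩ := hF
    have hnc := nonCrossing_splitLift hr e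
    have hR := negInvariant_splitLift r e
    have he := kreweras_splitLift_self r e
    refine ⟨(((splitLift r e).classes, (kreweras (splitLift r e)).classes),
        {x | kreweras (splitLift r e) x (posMap m e)}),
      ⟨(ncbPart_classes_iff _).2 ⟨hnc, hR⟩, ?_, (isKr_classes_iff hnc).2 rfl,
        Setoid.mem_classes _ _, (negSet_class_eq_iff hR.kreweras).2 he⟩, ?_⟩
    · rintro ⟨_, ⟨z, rfl⟩, hz⟩
      exact not_kreweras_negMap ((negSet_class_eq_iff hR).1 hz) he
    · rw [absTriple_classes hnc hR, image_absMap_class hR.kreweras, absSetoid_kreweras hnc hR]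
      rw [absSetoid_splitLift, absMap_posMap]

/-! ### Products over representatives of the pairs of non-zero-blocks -/

theorem isRep_or_isRep_negSet {X : Set (Fin (2 * m))} (hX : X.Nonempty) :
    IsRep m X ∨ IsRep m (negSet m X) := by
  obtain ⟨x, hx⟩ := (X ∪ negSet m X).toFinite.exists_minimal
    (hX.mono Set.subset_union_left)
  have hleast : IsLeast (X ∪ negSet m X) x :=
    ⟨hx.1, fun y hy => (le_total x y).elim id fun h => hx.2 hy h⟩
  rcases hx.1 with h | h
  · exact .inl ⟨x, hleast, h⟩
  · exact .inr ⟨x, by rwa [negSet_negSet, Set.union_comm], h⟩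

theorem finprod_rep_blocks {M : Type*} [CommMonoid M] {R : Setoid (Fin (2 * m))}
    (hR : NegInvariant R) (h : ℕ → M) :
    (∏ᶠ X ∈ {X | X ∈ R.classes ∧ negSet m X ≠ X ∧ IsRep m X}, h X.ncard) =
      ∏ᶠ F ∈ {F | ∃ X ∈ R.classes, negSet m X ≠ X ∧ F = absMap m '' X}, h F.ncard := by
  refine finprod_mem_eq_of_bijOn (fun X => absMap m '' X) ⟨?_, ?_, ?_⟩ ?_
  · rintro X ⟨hX, hne, -⟩
    exact ⟨X, hX, hne, rfl⟩
  · rintro _ ⟨⟨x, rfl⟩, hne, u, hu, hux⟩ _ ⟨⟨y, rfl⟩, -, v, hv, hvy⟩ heq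
    obtain ⟨x', hx', hxy⟩ : absMap m x ∈ absMap m '' {z | R z y} := by
      rw [← show absMap m '' {z | R z x} = absMap m '' {z | R z y} from heq]
      exact ⟨x, R.refl' x, rfl⟩
    rcases eq_or_eq_negMap_of_absMap_eq hxy with rfl | rfl
    · ext a
      exact ⟨fun ha => R.trans' ha hx', fun ha => R.trans' ha (R.symm' hx')⟩
    · exfalso
      have hy : {z | R z y} = negSet m {z | R z x} := by
        rw [negSet_class hR]
        ext a
        exact ⟨fun ha => R.trans' ha (R.symm' hx'), fun ha => R.trans' ha hx'⟩
      rw [hy, negSet_negSet, Set.union_comm] at hv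
      have huv := hu.unique hv
      rw [hy, ← huv, negSet_class hR] at hvy
      apply hne
      rw [negSet_class_eq_iff hR]
      exact R.trans' (R.symm' hux) hvy
  · rintro _ ⟨X, hX, hne, rfl⟩
    have hnonempty := (isPartition_classes R).1 X hX
    rcases isRep_or_isRep_negSet hnonempty with h' | h'
    · exact ⟨X, ⟨hX, hne, h'⟩, rfl⟩
    · refine ⟨negSet m X, ⟨?_, ?_, h'⟩, absMap_image_negSet X⟩
      · obtain ⟨z, rfl⟩ := hX
        rw [negSet_class hR]
        exact R.mem_classes _
      · rw [negSet_negSet]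
        exact hne.symm
  · rintro _ ⟨⟨x, rfl⟩, hne, -⟩
    rw [Set.InjOn.ncard_image]
    intro a ha b hb hab
    refine (eq_or_eq_negMap_of_absMap_eq hab).resolve_right ?_
    rintro rfl
    apply hne
    rw [negSet_class_eq_iff hR]
    exact R.trans' (R.symm' hb) (hR.negMap_left.1 ha)

theorem finprod_rep_blocks_of_zeroBlock {M : Type*} [CommMonoid M]
    {R : Setoid (Fin (2 * m))} (hnc : NonCrossing R) (hR : NegInvariant R)
    {z : Fin (2 * m)} (hz : R z (negMap m z)) (h : ℕ → M) :
    (∏ᶠ X ∈ {X | X ∈ R.classes ∧ negSet m X ≠ X ∧ IsRep m X}, h X.ncard) =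
      ∏ᶠ F ∈ (absSetoid R hR).classes \ {absMap m '' {x | R x z}}, h F.ncard := by
  rw [finprod_rep_blocks hR, ← absPart_classes hR]
  refine congr_arg (fun s : Set (Set (Fin m)) => ∏ᶠ F ∈ s, h F.ncard) (Set.ext fun F => ?_)
  constructor
  · rintro ⟨_, ⟨x, rfl⟩, hne, rfl⟩
    refine ⟨⟨_, R.mem_classes x, rfl⟩, fun heq => hne ?_⟩
    rw [negSet_class_eq_iff hR]
    have hx : x ∈ {x | R x z} := by
      rw [← absMap_mem_image_iff_of_negSet_eq ((negSet_class_eq_iff hR).2 hz), ← heq]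
      exact ⟨x, R.refl' x, rfl⟩
    exact R.trans' hx (R.trans' hz (R.symm' (hR _ _ hx)))
  · rintro ⟨⟨_, ⟨x, rfl⟩, rfl⟩, hne⟩
    refine ⟨_, R.mem_classes x, fun heq => hne ?_, rfl⟩
    have hxz := rel_of_rel_negMap hnc ((negSet_class_eq_iff hR).1 heq) hz
    rw [Set.mem_singleton_iff]
    congr 1
    ext a
    exact ⟨fun ha => R.trans' ha hxz, fun ha => R.trans' ha (R.symm' hxz)⟩

theorem finprod_rep_blocks_of_forall_not {M : Type*} [CommMonoid M]
    {R : Setoid (Fin (2 * m))} (hR : NegInvariant R) (hz : ∀ z, ¬ R z (negMap m z))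
    (h : ℕ → M) :
    (∏ᶠ X ∈ {X | X ∈ R.classes ∧ negSet m X ≠ X ∧ IsRep m X}, h X.ncard) =
      ∏ᶠ F ∈ (absSetoid R hR).classes, h F.ncard := by
  rw [finprod_rep_blocks hR, ← absPart_classes hR]
  refine congr_arg (fun s : Set (Set (Fin m)) => ∏ᶠ F ∈ s, h F.ncard) (Set.ext fun F => ?_)
  constructor
  · rintro ⟨X, hX, -, rfl⟩
    exact ⟨X, hX, rfl⟩
  · rintro ⟨_, ⟨x, rfl⟩, rfl⟩
    exact ⟨_, R.mem_classes x, fun heq => hz x ((negSet_class_eq_iff hR).1 heq), rfl⟩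

end Bijection

/-! ### Comparison of the two boxed convolutions -/

theorem finsum_mem_prod_eq {α β M : Type*} [Finite α] [Finite β] [AddCommMonoid M]
    (P : α → Prop) (Q : α → Set β) (H : α × β → M) :
    (∑ᶠ t ∈ {t : α × β | P t.1 ∧ t.2 ∈ Q t.1}, H t) =
      ∑ᶠ (x) (_ : P x), ∑ᶠ y ∈ Q x, H (x, y) := by
  rw [finsum_curry _ (Set.toFinite _)]
  refine finsum_congr fun x => ?_
  by_cases hx : P x <;> simp [hx]

theorem snd_finprod_mem {α R : Type*} [Finite α] [CommRing R] (s : Set α)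
    (u : α → DualNumber R) :
    (∏ᶠ a ∈ s, u a).snd =
      ∑ᶠ a ∈ s, (∏ᶠ b ∈ s \ {a}, (u b).fst) * (u a).snd := by
  have := Fintype.ofFinite α
  obtain ⟨s, rfl⟩ : ∃ t : Finset α, s = t := ⟨s.toFinset, by simp⟩
  have hdiff : ∀ a, (s : Set α) \ {a} = (s.erase a : Finset α) := fun a => by simp
  simp only [hdiff, finprod_mem_coe_finset, finsum_mem_coe_finset]
  induction s using Finset.induction_on with
  | empty => simp
  | insert a s ha ih =>
    have hfst : (∏ b ∈ s, u b).fst = ∏ b ∈ s, (u b).fst :=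
      map_prod (TrivSqZeroExt.fstHom R R R) u s
    rw [Finset.prod_insert ha, Finset.sum_insert ha, Finset.erase_insert ha,
      TrivSqZeroExt.snd_mul, ih (fun a => by simp), hfst, add_comm]
    congr 1
    · simp [mul_comm]
    · rw [smul_eq_mul, Finset.mul_sum]
      refine Finset.sum_congr rfl fun b hb => ?_
      have hab : a ≠ b := fun h => ha (h ▸ hb)
      rw [Finset.erase_insert_of_ne hab,
        Finset.prod_insert fun h => ha (Finset.mem_of_mem_erase h), mul_assoc]

theorem fst_finprod_mem {α R : Type*} [Finite α] [CommRing R] (s : Set α)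
    (u : α → DualNumber R) : (∏ᶠ a ∈ s, u a).fst = ∏ᶠ a ∈ s, (u a).fst :=
  (TrivSqZeroExt.fstHom R R R).toMonoidHom.map_finprod_mem u s.toFinite


theorem finsum_ncb_zeroBlock {m : ℕ} (a' a'' b' : ℕ → ℂ) :
    (∑ᶠ (t : (Set (Set (Fin (2 * m))) × Set (Set (Fin (2 * m)))) × Set (Fin (2 * m)))
      (_ : NCBPart m t.1.1 ∧ IsKr (2 * m) t.1.1 t.1.2 ∧ t.2 ∈ t.1.1 ∧ negSet m t.2 = t.2),
      (∏ᶠ X ∈ {X | X ∈ t.1.1 ∧ negSet m X ≠ X ∧ IsRep m X}, a' X.ncard) *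
        a'' (t.2.ncard / 2) *
        (∏ᶠ Y ∈ {Y | Y ∈ t.1.2 ∧ negSet m Y ≠ Y ∧ IsRep m Y}, b' Y.ncard)) =
    ∑ᶠ (pq : Set (Set (Fin m)) × Set (Set (Fin m))) (_ : NCPart pq.1 ∧ IsKr m pq.1 pq.2),
      ∑ᶠ F ∈ pq.1, (∏ᶠ G ∈ pq.1 \ {F}, a' G.ncard) * a'' F.ncard *
        ∏ᶠ E ∈ pq.2, b' E.ncard := by
  rw [← finsum_mem_prod_eq (fun pq : Set (Set (Fin m)) × Set (Set (Fin m)) =>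
    NCPart pq.1 ∧ IsKr m pq.1 pq.2) (fun pq => pq.1) (fun t =>
      (∏ᶠ G ∈ t.1.1 \ {t.2}, a' G.ncard) * a'' t.2.ncard * ∏ᶠ E ∈ t.1.2, b' E.ncard)]
  refine finsum_mem_eq_of_bijOn (absTriple m) bijOn_absTriple_zeroBlock ?_
  rintro ⟨⟨π, κ⟩, Z⟩ ⟨hπ, hκ, hZ, hZZ⟩
  obtain ⟨R, hnc, hR, rfl, rfl⟩ := exists_of_ncbPart hπ hκ
  obtain ⟨z, rfl⟩ := hZ
  have hz := (negSet_class_eq_iff hR).1 hZZ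
  rw [absTriple_classes hnc hR]
  dsimp only at hZZ ⊢
  rw [finprod_rep_blocks_of_zeroBlock hnc hR hz,
    finprod_rep_blocks_of_forall_not hR.kreweras fun c => not_kreweras_negMap hz,
    absSetoid_kreweras hnc hR, ncard_of_negSet_eq hZZ, Nat.mul_div_cancel_left _ two_pos]

theorem finsum_ncb_kreweras_zeroBlock {m : ℕ} (a' b' b'' : ℕ → ℂ) :
    (∑ᶠ (t : (Set (Set (Fin (2 * m))) × Set (Set (Fin (2 * m)))) × Set (Fin (2 * m)))
      (_ : NCBPart m t.1.1 ∧ (¬ ∃ Z ∈ t.1.1, negSet m Z = Z) ∧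
        IsKr (2 * m) t.1.1 t.1.2 ∧ t.2 ∈ t.1.2 ∧ negSet m t.2 = t.2),
      (∏ᶠ X ∈ {X | X ∈ t.1.1 ∧ negSet m X ≠ X ∧ IsRep m X}, a' X.ncard) *
        b'' (t.2.ncard / 2) *
        (∏ᶠ Y ∈ {Y | Y ∈ t.1.2 ∧ negSet m Y ≠ Y ∧ IsRep m Y}, b' Y.ncard)) =
    ∑ᶠ (pq : Set (Set (Fin m)) × Set (Set (Fin m))) (_ : NCPart pq.1 ∧ IsKr m pq.1 pq.2),
      ∑ᶠ E ∈ pq.2, (∏ᶠ F ∈ pq.1, a' F.ncard) * b'' E.ncard *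
        ∏ᶠ G ∈ pq.2 \ {E}, b' G.ncard := by
  rw [← finsum_mem_prod_eq (fun pq : Set (Set (Fin m)) × Set (Set (Fin m)) =>
    NCPart pq.1 ∧ IsKr m pq.1 pq.2) (fun pq => pq.2) (fun t =>
      (∏ᶠ F ∈ t.1.1, a' F.ncard) * b'' t.2.ncard * ∏ᶠ G ∈ t.1.2 \ {t.2}, b' G.ncard)]
  refine finsum_mem_eq_of_bijOn (absTriple m) bijOn_absTriple_kreweras_zeroBlock ?_
  rintro ⟨⟨π, κ⟩, Z⟩ ⟨hπ, hno, hκ, hZ, hZZ⟩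
  obtain ⟨R, hnc, hR, rfl, rfl⟩ := exists_of_ncbPart hπ hκ
  obtain ⟨z, rfl⟩ := hZ
  have hz := (negSet_class_eq_iff hR.kreweras).1 hZZ
  rw [absTriple_classes hnc hR]
  dsimp only at hZZ hno ⊢
  rw [finprod_rep_blocks_of_forall_not hR fun c hc =>
      hno ⟨_, R.mem_classes c, (negSet_class_eq_iff hR).2 hc⟩,
    finprod_rep_blocks_of_zeroBlock (nonCrossing_kreweras R) hR.kreweras hz,
    absSetoid_kreweras hnc hR, ncard_of_negSet_eq hZZ, Nat.mul_div_cancel_left _ two_pos]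

theorem fst_boxedA (f g : ℕ → DualNumber ℂ) (k : ℕ) :
    (boxedA f g k).fst =
      gammaFst (fun j => (f (j - 1)).fst) (fun j => (g (j - 1)).fst) (k + 1) := by
  refine ((TrivSqZeroExt.fstHom ℂ ℂ ℂ).toAddMonoidHom.map_finsum_mem _
    (Set.toFinite {pq : Set (Set (Fin (k + 1))) × Set (Set (Fin (k + 1))) |
      NCPart pq.1 ∧ IsKr (k + 1) pq.1 pq.2})).trans (finsum_mem_congr rfl fun pq _ => ?_)
  exact (TrivSqZeroExt.fst_mul _ _).trans
    (congr_arg₂ (· * ·) (fst_finprod_mem _ _) (fst_finprod_mem _ _))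

theorem snd_boxedA (f g : ℕ → DualNumber ℂ) (k : ℕ) :
    (boxedA f g k).snd =
      gammaSnd (fun j => (f (j - 1)).fst) (fun j => (f (j - 1)).snd)
        (fun j => (g (j - 1)).fst) (fun j => (g (j - 1)).snd) (k + 1) := by
  refine Eq.trans ?_ (congr_arg₂ (· + ·)
    (finsum_ncb_zeroBlock (fun j => (f (j - 1)).fst) (fun j => (f (j - 1)).snd)
      (fun j => (g (j - 1)).fst)).symm
    (finsum_ncb_kreweras_zeroBlock (fun j => (f (j - 1)).fst) (fun j => (g (j - 1)).fst)
      (fun j => (g (j - 1)).snd)).symm)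
  have hfin := Set.toFinite {pq : Set (Set (Fin (k + 1))) × Set (Set (Fin (k + 1))) |
      NCPart pq.1 ∧ IsKr (k + 1) pq.1 pq.2}
  refine ((TrivSqZeroExt.sndHom ℂ ℂ).toAddMonoidHom.map_finsum_mem _ hfin).trans
    (Eq.trans (finsum_mem_congr rfl fun pq _ => ?_) (finsum_mem_add_distrib hfin))
  refine (TrivSqZeroExt.snd_mul _ _).trans ?_
  rw [fst_finprod_mem, fst_finprod_mem, snd_finprod_mem, snd_finprod_mem, add_comm,
    op_smul_eq_smul, smul_eq_mul, smul_eq_mul, mul_comm,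
    finsum_mem_mul, mul_finsum_mem]
  refine congr_arg₂ (· + ·) rfl (finsum_mem_congr rfl fun E _ => ?_)
  ring

end NCPB
open NCPB in
/-- The boxed convolution of type B coincides with the boxed
convolution of type A with coefficients in the algebra `C = ℂ[x]/(x²)` (the dual
numbers over `ℂ`, i.e. `ℂ²` with multiplication
`(α',α'')·(β',β'') = (α'β', α'β'' + α''β')`). -/
theorem boxedB_eq_boxedA_dualNumber (f g : ℕ → DualNumber ℂ) :
    boxedB f g = boxedA f g := by
  funext k
  refine TrivSqZeroExt.ext ?_ ?_
  · rw [fst_boxedA]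
    simp [boxedB, mkD]
  · rw [snd_boxedA]
    simp [boxedB, mkD]
end

section
/- Let (A, φ, V, f, Φ) be a non-commutative probability space of type B, and let n be a positive integer. For all a₁,...,a_n ∈ A and ξ₁,...,ξ_n ∈ V, the non-crossing cumulant of type B satisfies κ^B_n((a₁,ξ₁),...,(a_n,ξ_n)) = ( κ^A_n(a₁,...,a_n), Σ_{m=1}^n κ^{A'}_n(a₁,...,a_{m-1}, ξ_m, a_{m+1},...,a_n) ), where κ^A_n are the non-crossing cumulant functionals of (A,φ) and κ^{A'}_n = κ^{A'}_{n;m} are the cumulant functionals with m-th argument in V. -/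
open scoped Classical

namespace NCPB

/-- The order-preserving enumeration of a subset `F` of `Fin N`. -/
noncomputable def enumSet {N : ℕ} (F : Set (Fin N)) (i : Fin F.ncard) : Fin N :=
  ((Set.toFinite F).toFinset.orderIsoOfFin
    (Set.ncard_eq_toFinset_card F (Set.toFinite F)).symm i).val

/-- The position of an element `j ∈ F` in the order-preserving enumeration of `F`. -/
noncomputable def idxIn {N : ℕ} (F : Set (Fin N)) (j : Fin N) (hj : j ∈ F) :
    Fin F.ncard :=
  ((Set.toFinite F).toFinset.orderIsoOfFin
    (Set.ncard_eq_toFinset_card F (Set.toFinite F)).symm).symm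
    ⟨j, (Set.Finite.mem_toFinset _).2 hj⟩

section NCPSB

variable (A : Type*) [Ring A] [Algebra ℂ A]
variable (V : Type*) [AddCommGroup V] [Module ℂ V]
variable [Module A V] [Module Aᵐᵒᵖ V] [SMulCommClass A Aᵐᵒᵖ V]

/-- The expectation `E : A × V → ℂ²` of a non-commutative probability space of type B,
on the linking algebra `A × V` (realized as `TrivSqZeroExt A V`, whose multiplication
is `(a,ξ)(b,η) = (ab, aη + ξb)`), with values in the algebra `ℂ²` (realized as the
dual numbers, whose multiplication is `(α',α'')(β',β'') = (α'β', α'β'' + α''β')`). -/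
noncomputable def expB (φ : A →ₗ[ℂ] ℂ) (f : V →ₗ[ℂ] ℂ) (x : TrivSqZeroExt A V) :
    DualNumber ℂ :=
  mkD (φ x.fst) (f x.snd)

/-- The family `κ^A_n : Aⁿ → ℂ` satisfies the moment-cumulant formula of type A:
`Σ_{p ∈ NC^A(n)} Π_{F block of p} κ^A_{|F|}((a₁,...,a_n)|F) = φ(a₁⋯a_n)` for `n ≥ 1`. -/
def MomCumA (φ : A →ₗ[ℂ] ℂ) (κA : (m : ℕ) → (Fin m → A) → ℂ) : Prop :=
  ∀ (N : ℕ) (a : Fin (N+1) → A),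
    (∑ᶠ (p : Set (Set (Fin (N+1)))) (_ : NCPart p),
      ∏ᶠ F ∈ p, κA F.ncard (fun i => a (enumSet F i))) = φ (List.ofFn a).prod

/-- The family `κ^{A'}_{n;m}` (with `m`-th argument a vector of `V`, encoded as
`κA' n a j ξ`, the entry `a j` being irrelevant) satisfies the moment-cumulant formula
of type A': for every position `j` of the vector,
`Σ_{p ∈ NC^A(n)} Π_{F block of p} κ^{A'}_{|F|}(...|F) = f(a₁ ⋯ a_{j-1} ξ a_{j+1} ⋯ a_n)`,
where within each block one uses `κ^{A'}` if the block contains `j` and `κ^A` otherwise. -/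
def MomCumA' (f : V →ₗ[ℂ] ℂ) (κA : (m : ℕ) → (Fin m → A) → ℂ)
    (κA' : (m : ℕ) → (Fin m → A) → Fin m → V → ℂ) : Prop :=
  (∀ (m : ℕ) (a a₀ : Fin m → A) (j : Fin m) (ξ : V),
      (∀ l, l ≠ j → a l = a₀ l) → κA' m a j ξ = κA' m a₀ j ξ) ∧
  ∀ (N : ℕ) (a : Fin (N+1) → A) (j : Fin (N+1)) (ξ : V),
    (∑ᶠ (p : Set (Set (Fin (N+1)))) (_ : NCPart p),
      ∏ᶠ F ∈ p,
        (if h : j ∈ F then κA' F.ncard (fun i => a (enumSet F i)) (idxIn F j h) ξ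
         else κA F.ncard (fun i => a (enumSet F i)))) =
    f ((List.ofFn (fun i => if i = j then (TrivSqZeroExt.inr ξ : TrivSqZeroExt A V)
          else TrivSqZeroExt.inl (a i))).prod).snd

/-- The family `κ^B_n : (A × V)ⁿ → ℂ²` satisfies the moment-cumulant formula of type B:
`Σ_{p ∈ NC^A(n)} Π_{F block of p} κ^B_{|F|}(((a₁,ξ₁),...,(a_n,ξ_n))|F)
  = E((a₁,ξ₁)⋯(a_n,ξ_n))` for `n ≥ 1`, the products over blocks being taken in the
algebra `ℂ²`. -/
def MomCumB (φ : A →ₗ[ℂ] ℂ) (f : V →ₗ[ℂ] ℂ)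
    (κB : (m : ℕ) → (Fin m → TrivSqZeroExt A V) → DualNumber ℂ) : Prop :=
  ∀ (N : ℕ) (x : Fin (N+1) → TrivSqZeroExt A V),
    (∑ᶠ (p : Set (Set (Fin (N+1)))) (_ : NCPart p),
      ∏ᶠ F ∈ p, κB F.ncard (fun i => x (enumSet F i))) =
    expB A V φ f (List.ofFn x).prod

end NCPSB

end NCPB
namespace NCPB

section Enumeration

variable {N : ℕ} (F : Set (Fin N))

theorem enumSet_mem (k : Fin F.ncard) : enumSet F k ∈ F :=
  (Set.Finite.mem_toFinset (Set.toFinite F)).1 (Subtype.property _)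

theorem enumSet_strictMono : StrictMono (enumSet F) := fun _ _ h =>
  ((Set.toFinite F).toFinset.orderIsoOfFin
    (Set.ncard_eq_toFinset_card F (Set.toFinite F)).symm).strictMono h

theorem enumSet_idxIn {j : Fin N} (hj : j ∈ F) : enumSet F (idxIn F j hj) = j := by
  simp [enumSet, idxIn]

theorem idxIn_enumSet (k : Fin F.ncard) (h : enumSet F k ∈ F) :
    idxIn F (enumSet F k) h = k :=
  (enumSet_strictMono F).injective (enumSet_idxIn F h)

theorem sum_dite_idxIn {M : Type*} [AddCommMonoid M] (g : Fin F.ncard → Fin N → M) :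
    ∑ j, (if h : j ∈ F then g (idxIn F j h) j else 0) = ∑ k, g k (enumSet F k) := by
  symm
  refine Fintype.sum_of_injective (enumSet F) (enumSet_strictMono F).injective _ _ ?_ ?_
  · intro j hj
    rw [dif_neg]
    exact fun h => hj ⟨idxIn F j h, enumSet_idxIn F h⟩
  · intro k
    rw [dif_pos (enumSet_mem F k), idxIn_enumSet]

theorem apply_comp_strictMono {α β : Type*} (κ : (m : ℕ) → (Fin m → α) → β)
    {m : ℕ} (h : m = N) (e : Fin m → Fin N) (he : StrictMono e) (x : Fin N → α) :
    κ m (fun i => x (e i)) = κ N x := by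
  subst h
  have : e = id := (StrictMono.range_inj he strictMono_id).1
    ((Finite.surjective_of_injective he.injective).range_eq.trans Set.range_id.symm)
  simp [this]

theorem apply_enumSet_univ {α β : Type*} (κ : (m : ℕ) → (Fin m → α) → β) (x : Fin N → α) :
    κ (Set.univ : Set (Fin N)).ncard (fun i => x (enumSet Set.univ i)) = κ N x :=
  apply_comp_strictMono κ (by simp [Set.ncard_univ]) _ (enumSet_strictMono _) x

end Enumeration

section Partitions

theorem ncPart_singleton_univ {α : Type*} [LinearOrder α] [Nonempty α] :
    NCPart ({Set.univ} : Set (Set α)) := by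
  refine ⟨⟨by simp, fun a => ⟨Set.univ, by simp, by simp⟩⟩, ?_⟩
  rintro B rfl C rfl
  simp

theorem IsPartition.eq_singleton_univ {α : Type*} {p : Set (Set α)} (hp : IsPartition p)
    (h : Set.univ ∈ p) : p = {Set.univ} := by
  refine Set.eq_singleton_iff_unique_mem.2 ⟨h, fun B hB => ?_⟩
  obtain ⟨b, hb⟩ := hp.1 B hB
  exact (hp.2 b).unique ⟨hB, hb⟩ ⟨h, Set.mem_univ b⟩

/-- The sum of the multiplicative extension of `κ` over all non-crossing partitions. -/
noncomputable def momentOfCumulant {α R : Type*} [CommRing R] (κ : (m : ℕ) → (Fin m → α) → R)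
    (N : ℕ) (x : Fin N → α) : R :=
  ∑ᶠ (p : Set (Set (Fin N))) (_ : NCPart p), ∏ᶠ F ∈ p, κ F.ncard (fun i => x (enumSet F i))

theorem cumulant_unique {α R : Type*} [CommRing R] {κ κ' : (m : ℕ) → (Fin m → α) → R}
    (h : ∀ (N : ℕ) (x : Fin (N + 1) → α),
      momentOfCumulant κ (N + 1) x = momentOfCumulant κ' (N + 1) x)
    (N : ℕ) (x : Fin (N + 1) → α) : κ (N + 1) x = κ' (N + 1) x := by
  induction N using Nat.strong_induction_on with
  | _ N ih =>
    have split : ∀ κ₀ : (m : ℕ) → (Fin m → α) → R, momentOfCumulant κ₀ (N + 1) x =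
        κ₀ (N + 1) x + ∑ p ∈ (Set.toFinite {p : Set (Set (Fin (N + 1))) | NCPart p}).toFinset.erase
          {Set.univ}, ∏ᶠ F ∈ p, κ₀ F.ncard (fun i => x (enumSet F i)) := by
      intro κ₀
      have hmem : ({Set.univ} : Set (Set (Fin (N + 1)))) ∈
          (Set.toFinite {p : Set (Set (Fin (N + 1))) | NCPart p}).toFinset := by
        simpa using ncPart_singleton_univ
      refine (finsum_mem_eq_finite_toFinset_sum _ (Set.toFinite {p | NCPart p})).trans ?_
      rw [← Finset.add_sum_erase _ _ hmem, finprod_mem_singleton, apply_enumSet_univ κ₀]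
    have key := h N x
    rw [split κ, split κ'] at key
    refine add_right_cancel (key.trans (congrArg _ (Finset.sum_congr rfl fun p hp => ?_)))
    have hp' : p ≠ {Set.univ} ∧ NCPart p := by simpa using hp
    refine finprod_mem_congr (M := R) rfl fun F hF => ?_
    have hlt : F.ncard < N + 1 := by
      have := Set.ncard_lt_card (s := F) fun hu =>
        hp'.1 (hp'.2.1.eq_singleton_univ (hu ▸ hF))
      simpa using this
    have hpos : 0 < F.ncard := (Set.ncard_pos (Set.toFinite F)).2 (hp'.2.1.1 F hF)
    generalize (fun i => x (enumSet F i)) = y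
    revert y
    obtain ⟨k, hk⟩ := Nat.exists_eq_succ_of_ne_zero hpos.ne'
    rw [hk] at hlt ⊢
    exact fun y => (ih k (by omega) y).symm

theorem IsPartition.prod_dite_mem {N : ℕ} {R : Type*} [CommRing R] {s : Finset (Set (Fin N))}
    (hs : IsPartition (s : Set (Set (Fin N)))) (j : Fin N)
    (u : (F : Set (Fin N)) → j ∈ F → R) (v : Set (Fin N) → R) :
    ∏ F ∈ s, (if h : j ∈ F then u F h else v F) =
      ∑ F ∈ s, (if h : j ∈ F then u F h else 0) * ∏ G ∈ s.erase F, v G := by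
  obtain ⟨B, ⟨hB, hjB⟩, huniq⟩ := hs.2 j
  have hB' : B ∈ s := hB
  have hout : ∀ G ∈ s, G ≠ B → j ∉ G := fun G hG hGB hjG => hGB (huniq G ⟨hG, hjG⟩)
  rw [Finset.sum_eq_single_of_mem B hB' fun G hG hGB => by rw [dif_neg (hout G hG hGB), zero_mul],
    ← Finset.mul_prod_erase s _ hB', dif_pos hjB, dif_pos hjB]
  refine congrArg _ (Finset.prod_congr rfl fun G hG => ?_)
  rw [dif_neg (hout G (Finset.mem_of_mem_erase hG) (Finset.ne_of_mem_erase hG))]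

end Partitions

section DualNumbers

@[simp] theorem fst_mkD (x y : ℂ) : (mkD x y).fst = x := by simp [mkD]

@[simp] theorem snd_mkD (x y : ℂ) : (mkD x y).snd = y := by simp [mkD]

theorem dualNumber_fst_prod {ι R : Type*} [CommRing R] (s : Finset ι) (d : ι → DualNumber R) :
    (∏ i ∈ s, d i).fst = ∏ i ∈ s, (d i).fst :=
  map_prod (TrivSqZeroExt.fstHom R R R) d s

theorem dualNumber_snd_prod {ι R : Type*} [DecidableEq ι] [CommRing R] (s : Finset ι) (d : ι → DualNumber R) :
    (∏ i ∈ s, d i).snd = ∑ i ∈ s, (d i).snd * ∏ j ∈ s.erase i, (d j).fst := by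
  induction s using Finset.induction_on with
  | empty => simp
  | insert b s hb ih =>
    rw [Finset.prod_insert hb, Finset.sum_insert hb, Finset.erase_insert hb,
      TrivSqZeroExt.snd_mul, ih, dualNumber_fst_prod, smul_eq_mul, Finset.mul_sum,
      MulOpposite.smul_eq_mul_unop, MulOpposite.unop_op, add_comm]
    congr 1
    refine Finset.sum_congr rfl fun i hi => ?_
    rw [Finset.erase_insert_of_ne (show b ≠ i from fun h => hb (h.symm ▸ hi)),
      Finset.prod_insert fun h => hb (Finset.mem_of_mem_erase h)]
    ring

end DualNumbers

section LinkingAlgebra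

variable {A : Type*} [Ring A] {V : Type*} [AddCommGroup V]
variable [Module A V] [Module Aᵐᵒᵖ V] [SMulCommClass A Aᵐᵒᵖ V]

theorem fst_prod_ofFn {n : ℕ} (x : Fin n → TrivSqZeroExt A V) :
    (List.ofFn x).prod.fst = (List.ofFn fun i => (x i).fst).prod := by
  rw [TrivSqZeroExt.fst_list_prod, List.map_ofFn]
  rfl

theorem snd_prod_ofFn {n : ℕ} (x : Fin n → TrivSqZeroExt A V) :
    (List.ofFn x).prod.snd = ∑ j, (List.ofFn fun i =>
      if i = j then (TrivSqZeroExt.inr (x j).snd : TrivSqZeroExt A V)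
      else TrivSqZeroExt.inl (x i).fst).prod.snd := by
  induction n with
  | zero => simp
  | succ n ih =>
    rw [List.ofFn_succ, List.prod_cons, TrivSqZeroExt.snd_mul, ih, fst_prod_ofFn,
      Finset.smul_sum, Fin.sum_univ_succ, add_comm]
    simp [List.ofFn_succ, fst_prod_ofFn, fun i : Fin n => (Fin.succ_ne_zero i).symm]

end LinkingAlgebra

section PairedCumulants

variable {A V : Type*}

/-- The `ℂ²`-valued functionals assembled from the cumulants of types A and A'. -/
noncomputable def pairCumulant (κA : (m : ℕ) → (Fin m → A) → ℂ)
    (κA' : (m : ℕ) → (Fin m → A) → Fin m → V → ℂ) (m : ℕ) (x : Fin m → TrivSqZeroExt A V) :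
    DualNumber ℂ :=
  mkD (κA m fun i => (x i).fst) (∑ j, κA' m (fun i => (x i).fst) j (x j).snd)

theorem IsPartition.finprod_pairCumulant {κA : (m : ℕ) → (Fin m → A) → ℂ}
    {κA' : (m : ℕ) → (Fin m → A) → Fin m → V → ℂ} {N : ℕ} {p : Set (Set (Fin N))}
    (hp : IsPartition p) (x : Fin N → TrivSqZeroExt A V) :
    ∏ᶠ F ∈ p, pairCumulant κA κA' F.ncard (fun i => x (enumSet F i)) =
      mkD (∏ᶠ F ∈ p, κA F.ncard (fun i => (x (enumSet F i)).fst))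
        (∑ j, ∏ᶠ F ∈ p, (if h : j ∈ F then
          κA' F.ncard (fun i => (x (enumSet F i)).fst) (idxIn F j h) (x j).snd
          else κA F.ncard (fun i => (x (enumSet F i)).fst))) := by
  obtain ⟨s, rfl⟩ := (Set.toFinite p).exists_finset_coe
  simp only [finprod_mem_coe_finset]
  ext
  · simp [dualNumber_fst_prod, pairCumulant]
  · rw [dualNumber_snd_prod, snd_mkD]
    simp only [hp.prod_dite_mem]
    rw [Finset.sum_comm]
    refine Finset.sum_congr rfl fun F _ => ?_
    rw [← Finset.sum_mul, sum_dite_idxIn F fun k j =>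
      κA' F.ncard (fun i => (x (enumSet F i)).fst) k (x j).snd]
    simp [pairCumulant]

variable [Ring A] [Algebra ℂ A] [AddCommGroup V] [Module ℂ V] [Module A V] [Module Aᵐᵒᵖ V] [SMulCommClass A Aᵐᵒᵖ V]

theorem momCumB_pairCumulant {φ : A →ₗ[ℂ] ℂ} {f : V →ₗ[ℂ] ℂ} {κA : (m : ℕ) → (Fin m → A) → ℂ}
    {κA' : (m : ℕ) → (Fin m → A) → Fin m → V → ℂ} (hA : MomCumA A φ κA)
    (hA' : MomCumA' A V f κA κA') : MomCumB A V φ f (pairCumulant κA κA') := by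
  intro N x
  have toSum {M : Type} [AddCommMonoid M] (g : Set (Set (Fin (N + 1))) → M) :
      ∑ᶠ (p : Set (Set (Fin (N + 1)))) (_ : NCPart p), g p =
        ∑ p ∈ (Set.toFinite {p : Set (Set (Fin (N + 1))) | NCPart p}).toFinset, g p :=
    finsum_mem_eq_finite_toFinset_sum g (Set.toFinite {p | NCPart p})
  have hfst := hA N fun i => (x i).fst
  have hsnd := fun j => hA'.2 N (fun i => (x i).fst) j (x j).snd
  rw [toSum] at hfst ⊢
  simp only [toSum] at hsnd
  have hnc {p} (hp : p ∈ (Set.toFinite {p : Set (Set (Fin (N + 1))) | NCPart p}).toFinset) :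
      IsPartition p := ((Set.Finite.mem_toFinset _).1 hp).1
  rw [Finset.sum_congr rfl fun p hp => (hnc hp).finprod_pairCumulant x, expB, fst_prod_ofFn,
    snd_prod_ofFn, map_sum, ← hfst]
  simp only [← hsnd]
  rw [Finset.sum_comm]
  ext
  · simp [TrivSqZeroExt.fst_sum]
  · simp [TrivSqZeroExt.snd_sum]

end PairedCumulants

end NCPB
open NCPB TrivSqZeroExt in
/-- In a non-commutative probability space of type B, the
non-crossing cumulants of type B are given componentwise by
`κ^B_n((a₁,ξ₁),...,(a_n,ξ_n)) =
  (κ^A_n(a₁,...,a_n), Σ_{m=1}^n κ^{A'}_n(a₁,...,a_{m-1},ξ_m,a_{m+1},...,a_n))`. -/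
theorem cumulantB_eq_cumulantA_pair
    (A : Type*) [Ring A] [Algebra ℂ A]
    (V : Type*) [AddCommGroup V] [Module ℂ V]
    [Module A V] [Module Aᵐᵒᵖ V] [SMulCommClass A Aᵐᵒᵖ V]
    (φ : A →ₗ[ℂ] ℂ) (hφ1 : φ 1 = 1) (f : V →ₗ[ℂ] ℂ)
    (κA : (m : ℕ) → (Fin m → A) → ℂ) (hA : MomCumA A φ κA)
    (κA' : (m : ℕ) → (Fin m → A) → Fin m → V → ℂ) (hA' : MomCumA' A V f κA κA')
    (κB : (m : ℕ) → (Fin m → TrivSqZeroExt A V) → DualNumber ℂ)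
    (hB : MomCumB A V φ f κB)
    (N : ℕ) (a : Fin (N+1) → A) (ξ : Fin (N+1) → V) :
    κB (N+1) (fun i => inl (a i) + inr (ξ i)) =
      mkD (κA (N+1) a) (∑ m : Fin (N+1), κA' (N+1) a m (ξ m)) := by
  have h := cumulant_unique (κ := κB) (κ' := pairCumulant κA κA')
    (fun M x => (hB M x).trans (momCumB_pairCumulant hA hA' M x).symm) N
    (fun i => inl (a i) + inr (ξ i))
  simpa [pairCumulant] using h
end
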